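/- arXiv:0707.3607 — 2 statements merged into one kernel-verified Lean document; each statement's English description precedes it below -/
import Mathlib

section
/- Let Γ_1 and Γ_2 be finite generalized layered graphs, each with a unique minimal vertex of rank 0 and a unique maximal vertex of rank d (with d ≥ 1), and let Γ_1 ◊ Γ_2 be the double bouquet obtained from the disjoint union of Γ_1 and Γ_2 by identifying the two minimal vertices with each other and the two maximal vertices with each other. Then M(Γ_1 ◊ Γ_2)(z) = M(Γ_1)(z) + M(Γ_2)(z) − (2 − z^d). -/
open scoped BigOperators

namespace GLG

variable {V E : Type}

def len (tl hd : E → V) (rk : V → ℕ) (e : E) : ℕ := rk (tl e) - rk (hd e)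
def IsRank (tl hd : E → V) (rk : V → ℕ) : Prop := ∀ e : E, rk (hd e) < rk (tl e)
def IsPathC (tl hd : E → V) (e : E) (es : List E) : Prop :=
  List.Chain (fun a b => hd a = tl b) e es
def pathDst (hd : E → V) (e : E) (es : List E) : V :=
  hd ((e :: es).getLast (List.cons_ne_nil e es))
def Reaches (tl hd : E → V) (v w : V) : Prop :=
  ∃ (e : E) (es : List E), IsPathC tl hd e es ∧ tl e = v ∧ pathDst hd e es = w

/-- The set `E^♯` of generators `a_i(e)`, `1 ≤ i ≤ l(e)`. -/
abbrev ESharp (tl hd : E → V) (rk : V → ℕ) : Type :=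
  Σ e : E, {i : ℕ // 1 ≤ i ∧ i ≤ len tl hd rk e}

/-- `P_e(t) = 1 + Σ_{j=1}^{l(e)} (-1)^j a_j(e) t^j`. -/
noncomputable def Pe (F : Type) [Field F] (tl hd : E → V) (rk : V → ℕ) (e : E) :
    Polynomial (FreeAlgebra F (ESharp tl hd rk)) :=
  1 + ∑ j ∈ (Finset.Icc 1 (len tl hd rk e)).attach,
      Polynomial.C ((-1 : FreeAlgebra F (ESharp tl hd rk)) ^ (j : ℕ) *
        FreeAlgebra.ι F (⟨e, ⟨(j : ℕ), (Finset.mem_Icc.mp j.2).1, (Finset.mem_Icc.mp j.2).2⟩⟩ :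
          ESharp tl hd rk)) *
      Polynomial.X ^ (j : ℕ)

/-- `e(π, j)`, the coefficient of `(-t)^j` in `P_π(t) = P_{e₁}(t) ⋯ P_{e_r}(t)`,
for `π` the path given by the list of edges `es`. -/
noncomputable def eP (F : Type) [Field F] (tl hd : E → V) (rk : V → ℕ)
    (es : List E) (j : ℕ) : FreeAlgebra F (ESharp tl hd rk) :=
  (-1 : FreeAlgebra F (ESharp tl hd rk)) ^ j * ((es.map (Pe F tl hd rk)).prod).coeff j

/-- The defining relations of `A(Γ)`: `e(π₁,j) = e(π₂,j)` for paths `π₁, π₂` with the same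
tail and the same head, and `1 ≤ j ≤ l(π₁)`. -/
def rel (F : Type) [Field F] (tl hd : E → V) (rk : V → ℕ) :
    FreeAlgebra F (ESharp tl hd rk) → FreeAlgebra F (ESharp tl hd rk) → Prop :=
  fun x y => ∃ (e1 : E) (es1 : List E) (e2 : E) (es2 : List E) (j : ℕ),
    IsPathC tl hd e1 es1 ∧ IsPathC tl hd e2 es2 ∧
    tl e1 = tl e2 ∧ pathDst hd e1 es1 = pathDst hd e2 es2 ∧
    1 ≤ j ∧ j ≤ rk (tl e1) - rk (pathDst hd e1 es1) ∧
    x = eP F tl hd rk (e1 :: es1) j ∧ y = eP F tl hd rk (e2 :: es2) j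

/-- The algebra `A(Γ) = T(E^♯)/R`. -/
noncomputable abbrev AGamma (F : Type) [Field F] (tl hd : E → V) (rk : V → ℕ) : Type :=
  RingQuot (rel F tl hd rk)

/-- The canonical projection `T(E^♯) → A(Γ)`. -/
noncomputable def mkA (F : Type) [Field F] (tl hd : E → V) (rk : V → ℕ) :
    FreeAlgebra F (ESharp tl hd rk) →ₐ[F] AGamma F tl hd rk :=
  RingQuot.mkAlgHom F (rel F tl hd rk)

/-- `f(a,j) = ja - j(j-1)/2`. -/
def fN (a j : ℕ) : ℕ := j * a - j * (j - 1) / 2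

/-- The filtration weight `|a_i(e)| = f(|t(e)|, i)` of a generator. -/
def wt (tl hd : E → V) (rk : V → ℕ) (s : ESharp tl hd rk) : ℕ := fN (rk (tl s.1)) s.2.1

/-- The filtration subspace `A(Γ)_n`: the span of the images of the products of generators
of total weight at most `n`. -/
noncomputable def filt (F : Type) [Field F] (tl hd : E → V) (rk : V → ℕ) (n : ℕ) :
    Submodule F (AGamma F tl hd rk) :=
  Submodule.span F {x : AGamma F tl hd rk | ∃ w : List (ESharp tl hd rk),
    (w.map (wt tl hd rk)).sum ≤ n ∧ x = mkA F tl hd rk ((w.map (FreeAlgebra.ι F)).prod)}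

/-- The degree-`n` homogeneous component `A(Γ)_{[n]}` (for the grading with `deg a_i(e) = i`):
the image in `A(Γ)` of the span of the words of total degree `n`. -/
noncomputable def gpiece (F : Type) [Field F] (tl hd : E → V) (rk : V → ℕ) (n : ℕ) :
    Submodule F (AGamma F tl hd rk) :=
  Submodule.span F {x : AGamma F tl hd rk | ∃ w : List (ESharp tl hd rk),
    (w.map (fun s => s.2.1)).sum = n ∧ x = mkA F tl hd rk ((w.map (FreeAlgebra.ι F)).prod)}

/-- The Hilbert series `H(A(Γ), z) = Σ_n dim_F A(Γ)_{[n]} · z^n ∈ ℤ[[z]]`. -/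
noncomputable def hilb (F : Type) [Field F] (tl hd : E → V) (rk : V → ℕ) : PowerSeries ℤ :=
  PowerSeries.mk fun n => (Module.finrank F (gpiece F tl hd rk n) : ℤ)


/-- `v ≥ w` in the poset of the graph. -/
def GE (tl hd : E → V) (v w : V) : Prop := v = w ∨ Reaches tl hd v w

/-- The Möbius function of the poset of the graph: the sum of `(-1)^(l+1)` over all
chains `v = v₁ > v₂ > ⋯ > v_l = w`. -/
noncomputable def mob (tl hd : E → V) (v w : V) : ℤ :=
  ∑ᶠ c ∈ {c : List V | c.Chain' (Reaches tl hd) ∧ c.head? = some v ∧ c.getLast? = some w},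
    (-1 : ℤ) ^ (c.length + 1)

/-- `M(Γ)(z) = Σ_{v ≥ w} μ(v,w) z^{|v|-|w|}`, as a formal power series over `ℤ`. -/
noncomputable def MGamma (tl hd : E → V) (rk : V → ℕ) : PowerSeries ℤ :=
  ∑ᶠ p ∈ {p : V × V | GE tl hd p.1 p.2},
    mob tl hd p.1 p.2 • (PowerSeries.X : PowerSeries ℤ) ^ (rk p.1 - rk p.2)

/-- `M_∘(Γ)(z) = Σ_{x ∈ V} μ(x, v_min) z^{|x|-|v_min|}`. -/
noncomputable def MLow (tl hd : E → V) (rk : V → ℕ) (vmin : V) : PowerSeries ℤ :=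
  ∑ᶠ x : V, mob tl hd x vmin • (PowerSeries.X : PowerSeries ℤ) ^ (rk x - rk vmin)

noncomputable def MUp (tl hd : E → V) (rk : V → ℕ) (vmax : V) : PowerSeries ℤ :=
  ∑ᶠ x : V, mob tl hd vmax x • (PowerSeries.X : PowerSeries ℤ) ^ (rk vmax - rk x)

end GLG

namespace GLG

variable {V1 E1 V2 E2 : Type}

/-- Vertex set of the double bouquet `Γ₁ ◊ Γ₂`: the vertices of `Γ₁` other than `*₁, v_max₁`,
the vertices of `Γ₂` other than `*₂, v_max₂`, the common minimal vertex `Sum.inr false` and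
the common maximal vertex `Sum.inr true`. -/
abbrev DbV (V1 V2 : Type) (s1 t1 : V1) (s2 t2 : V2) : Type :=
  ({v : V1 // v ≠ s1 ∧ v ≠ t1} ⊕ {v : V2 // v ≠ s2 ∧ v ≠ t2}) ⊕ Bool

open Classical in
/-- The embedding of the vertices of `Γ₁` into the double bouquet. -/
noncomputable def dbEmb1 (s1 t1 : V1) (s2 t2 : V2) : V1 → DbV V1 V2 s1 t1 s2 t2 :=
  fun v =>
    if h1 : v = s1 then Sum.inr false
    else if h2 : v = t1 then Sum.inr true
    else Sum.inl (Sum.inl ⟨v, h1, h2⟩)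

open Classical in
/-- The embedding of the vertices of `Γ₂` into the double bouquet. -/
noncomputable def dbEmb2 (s1 t1 : V1) (s2 t2 : V2) : V2 → DbV V1 V2 s1 t1 s2 t2 :=
  fun v =>
    if h1 : v = s2 then Sum.inr false
    else if h2 : v = t2 then Sum.inr true
    else Sum.inl (Sum.inr ⟨v, h1, h2⟩)

/-- Tail map of the double bouquet. -/
noncomputable def dbTl (tl1 : E1 → V1) (tl2 : E2 → V2) (s1 t1 : V1) (s2 t2 : V2) :
    E1 ⊕ E2 → DbV V1 V2 s1 t1 s2 t2 :=
  Sum.elim (fun e => dbEmb1 s1 t1 s2 t2 (tl1 e)) (fun e => dbEmb2 s1 t1 s2 t2 (tl2 e))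

/-- Head map of the double bouquet. -/
noncomputable def dbHd (hd1 : E1 → V1) (hd2 : E2 → V2) (s1 t1 : V1) (s2 t2 : V2) :
    E1 ⊕ E2 → DbV V1 V2 s1 t1 s2 t2 :=
  Sum.elim (fun e => dbEmb1 s1 t1 s2 t2 (hd1 e)) (fun e => dbEmb2 s1 t1 s2 t2 (hd2 e))

/-- Rank function of the double bouquet (`d` is the common rank of the maximal vertices). -/
def dbRk (rk1 : V1 → ℕ) (rk2 : V2 → ℕ) (s1 t1 : V1) (s2 t2 : V2) (d : ℕ) :
    DbV V1 V2 s1 t1 s2 t2 → ℕ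
  | Sum.inl (Sum.inl v) => rk1 v.1
  | Sum.inl (Sum.inr v) => rk2 v.1
  | Sum.inr b => if b then d else 0

end GLG

namespace GLG

noncomputable def mobR {V : Type} (R : V → V → Prop) (v w : V) : ℤ :=
  ∑ᶠ c ∈ {c : List V | c.IsChain R ∧ c.head? = some v ∧ c.getLast? = some w},
    (-1 : ℤ) ^ (c.length + 1)

theorem reaches_iff {V E : Type} (tl hd : E → V) (v w : V) :
    Reaches tl hd v w ↔ Relation.TransGen (fun a b => ∃ e, tl e = a ∧ hd e = b) v w := by
  constructor
  · rintro ⟨e, es, h, rfl, rfl⟩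
    induction es generalizing e with
    | nil => exact .single ⟨e, rfl, by simp [pathDst]⟩
    | cons a l ih =>
      have h' := List.isChain_cons_cons.1 h
      refine .head ⟨e, rfl, h'.1⟩ ?_
      have := ih a h'.2
      simpa [pathDst] using this
  · intro h
    induction h using Relation.TransGen.head_induction_on with
    | single h =>
      obtain ⟨e, rfl, rfl⟩ := h
      exact ⟨e, [], List.isChain_singleton _, rfl, by simp [pathDst]⟩
    | head h _ ih =>
      obtain ⟨e, rfl, he⟩ := h
      obtain ⟨a, l, h1, h2, h3⟩ := ih
      refine ⟨e, a :: l, List.isChain_cons_cons.2 ⟨he.trans h2.symm, h1⟩, rfl, ?_⟩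
      simpa [pathDst] using h3

theorem transGen_rk {V : Type} (S : V → V → Prop) (rk : V → ℕ)
    (h : ∀ v w, S v w → rk w < rk v) {v w : V} (hvw : Relation.TransGen S v w) : rk w < rk v := by
  induction hvw with
  | single h' => exact h _ _ h'
  | tail _ h' ih => exact (h _ _ h').trans ih

theorem chains_finite {V : Type} [Fintype V] (R : V → V → Prop) (rk : V → ℕ)
    (h : ∀ v w, R v w → rk w < rk v) : {c : List V | c.IsChain R}.Finite := by
  refine (List.finite_length_le V (Fintype.card V)).subset ?_
  intro c hc
  have hc : c.IsChain R := hc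
  have h1 : (c.map rk).IsChain (· > ·) := by
    rw [List.isChain_map]
    exact hc.imp (fun a b hab => h a b hab)
  have h2 := (List.isChain_iff_pairwise.1 h1)
  have h3 : c.Nodup := by
    rw [List.pairwise_map] at h2
    exact h2.imp (fun hab => by rintro rfl; exact lt_irrefl _ hab)
  exact h3.length_le_card

open Classical in
theorem mobR_rec {V : Type} [Fintype V] (R : V → V → Prop) (rk : V → ℕ)
    (h : ∀ v w, R v w → rk w < rk v) (v w : V) :
    mobR R v w = (if v = w then 1 else 0) - ∑ u, if R v u then mobR R u w else 0 := by
  set S : V → Set (List V) := fun u => {c : List V | c.IsChain R ∧ c.head? = some u ∧ c.getLast? = some w} with hS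
  have hfin : ∀ u, (S u).Finite := fun u => (chains_finite R rk h).subset (fun c hc => hc.1)
  have hm : ∀ u, mobR R u w = ∑ᶠ c ∈ S u, (-1 : ℤ) ^ (c.length + 1) := fun u => rfl
  set A : Set (List V) := if v = w then {[v]} else ∅ with hA
  set T : V → Set (List V) := fun u => if R v u then (fun c => v :: c) '' S u else ∅ with hT
  have hsplit : S v = A ∪ ⋃ u, T u := by
    ext c
    simp only [hS, hA, hT, Set.mem_union, Set.mem_iUnion, Set.mem_ofPred_eq]
    constructor
    · rintro ⟨h1, h2, h3⟩
      match c with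
      | [] => simp at h2
      | [a] =>
        left
        simp at h2 h3
        subst h2; subst h3; simp
      | a :: b :: l =>
        right
        simp at h2
        subst h2
        rw [List.isChain_cons_cons] at h1
        refine ⟨b, ?_⟩
        rw [if_pos h1.1]
        exact ⟨b :: l, ⟨h1.2, by simp, by simpa using h3⟩, rfl⟩
    · rintro (h1 | ⟨u, h1⟩)
      · split_ifs at h1 with hvw
        · subst hvw
          have : c = [v] := h1
          subst this
          simp
        · exact absurd h1 (Set.notMem_empty _)
      · split_ifs at h1 with hvu
        · obtain ⟨c', ⟨k1, k2, k3⟩, rfl⟩ := h1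
          match c' with
          | [] => simp at k2
          | b :: l =>
            simp at k2
            subst k2
            exact ⟨List.isChain_cons_cons.2 ⟨hvu, k1⟩, by simp, by simpa using k3⟩
        · exact absurd h1 (Set.notMem_empty _)
  have hTfin : ∀ u, (T u).Finite := by
    intro u
    simp only [hT]
    split_ifs
    · exact (hfin u).image _
    · exact Set.finite_empty
  have hAfin : A.Finite := by
    simp only [hA]
    split_ifs
    · exact Set.finite_singleton _
    · exact Set.finite_empty
  have hTmem : ∀ u c, c ∈ T u → ∃ l, c = v :: u :: l := by
    intro u c hc
    simp only [hT] at hc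
    split_ifs at hc
    · obtain ⟨c', ⟨k1, k2, k3⟩, rfl⟩ := hc
      match c' with
      | [] => simp at k2
      | b :: l =>
        simp at k2
        subst k2
        exact ⟨l, rfl⟩
    · exact absurd hc (Set.notMem_empty _)
  have hdisj : Disjoint A (⋃ u, T u) := by
    rw [Set.disjoint_left]
    intro c hc hc'
    obtain ⟨u, hu⟩ := Set.mem_iUnion.1 hc'
    obtain ⟨l, rfl⟩ := hTmem u c hu
    simp only [hA] at hc
    split_ifs at hc
    · have : v :: u :: l = [v] := hc
      simp at this
    · exact hc
  have hpd : Pairwise (fun i j => Disjoint (T i) (T j)) := by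
    intro i j hij
    rw [Set.disjoint_left]
    intro c hc hc'
    obtain ⟨l, rfl⟩ := hTmem i c hc
    obtain ⟨l', hl'⟩ := hTmem j _ hc'
    simp at hl'
    exact hij hl'.1
  rw [hm, hsplit, finsum_mem_union hdisj hAfin (Set.finite_iUnion hTfin),
    finsum_mem_iUnion hpd hTfin,
    finsum_eq_sum_of_fintype (fun i : V => ∑ᶠ c ∈ T i, (-1 : ℤ) ^ (c.length + 1)), sub_eq_add_neg, ← Finset.sum_neg_distrib]
  congr 1
  · simp only [hA]
    split_ifs <;> simp
  · refine Finset.sum_congr rfl fun u _ => ?_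
    simp only [hT]
    split_ifs
    · rw [finsum_mem_image (fun a _ b _ hab => by simpa using hab), hm, ← finsum_mem_neg_distrib _ (hfin u)]
      refine finsum_mem_congr rfl fun c _ => ?_
      simp [pow_succ]
    · simp

theorem mobR_zero {V : Type} (R : V → V → Prop) 
    (htr : ∀ a b c, R a b → R b c → R a c) (v w : V) (hne : v ≠ w) (hR : ¬ R v w) :
    mobR R v w = 0 := by
  have : {c : List V | c.IsChain R ∧ c.head? = some v ∧ c.getLast? = some w} = ∅ := by
    ext c
    simp only [Set.mem_ofPred_eq, Set.mem_empty_iff_false, iff_false]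
    rintro ⟨h1, h2, h3⟩
    have : IsTrans V R := ⟨htr⟩
    match c with
    | [] => simp at h2
    | a :: l =>
      simp at h2
      subst h2
      have hp := List.isChain_iff_pairwise.1 h1
      have hw := List.mem_of_getLast? h3
      rcases List.mem_cons.1 hw with h | h
      · exact hne h.symm
      · exact hR ((List.pairwise_cons.1 hp).1 _ h)
  rw [mobR, this]
  simp

theorem mobR_self {V : Type} [Fintype V] (R : V → V → Prop) (rk : V → ℕ)
    (h : ∀ v w, R v w → rk w < rk v) 
    (htr : ∀ a b c, R a b → R b c → R a c) (v : V) : mobR R v v = 1 := by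
  classical
  rw [mobR_rec R rk h, if_pos rfl, Finset.sum_eq_zero, sub_zero]
  intro u _
  split_ifs with hu
  · apply mobR_zero R htr
    · rintro rfl; exact lt_irrefl _ (h _ _ hu)
    · intro hu'; exact lt_asymm (h _ _ hu) (h _ _ hu')
  · rfl

theorem MGamma_eq {V E : Type} [Fintype V] (tl hd : E → V) (rk : V → ℕ) :
    MGamma tl hd rk = ∑ v, ∑ w, mobR (Reaches tl hd) v w • (PowerSeries.X : PowerSeries ℤ) ^ (rk v - rk w) := by
  have htr : ∀ a b c, Reaches tl hd a b → Reaches tl hd b c → Reaches tl hd a c := by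
    intro a b c
    simp only [reaches_iff]
    exact Relation.TransGen.trans
  rw [← Fintype.sum_prod_type', ← finsum_eq_sum_of_fintype, MGamma]
  refine finsum_congr fun p => ?_
  by_cases hp : GE tl hd p.1 p.2
  · simp only [Set.mem_ofPred_eq, hp, finsum_true]; rfl
  · simp only [Set.mem_ofPred_eq, hp, finsum_false]
    simp only [GE, not_or] at hp
    rw [mobR_zero _ htr _ _ hp.1 hp.2, zero_smul]

theorem reach_emb {V V1 : Type} (S : V → V → Prop) (S1 : V1 → V1 → Prop) (emb : V1 → V) (t1 : V1)
    (hemb : ∀ v x, v ≠ t1 → (S (emb v) x ↔ ∃ u, x = emb u ∧ S1 v u))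
    (ht : ∀ v, ¬ S1 v t1) (v : V1) (hv : v ≠ t1) (x : V) :
    Relation.TransGen S (emb v) x ↔ ∃ u, x = emb u ∧ Relation.TransGen S1 v u := by
  have ht' : ∀ v, ¬ Relation.TransGen S1 v t1 := by
    intro v h
    obtain ⟨b, _, hb⟩ := Relation.TransGen.tail'_iff.1 h
    exact ht _ hb
  constructor
  · intro h
    induction h with
    | single h =>
      obtain ⟨u, rfl, hu⟩ := (hemb _ _ hv).1 h
      exact ⟨u, rfl, .single hu⟩
    | tail _ h ih =>
      obtain ⟨u, rfl, hu⟩ := ih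
      have : u ≠ t1 := by rintro rfl; exact ht' _ hu
      obtain ⟨u', rfl, hu'⟩ := (hemb _ _ this).1 h
      exact ⟨u', rfl, hu.tail hu'⟩
  · rintro ⟨u, rfl, hu⟩
    induction hu with
    | single h => exact .single ((hemb _ _ hv).2 ⟨_, rfl, h⟩)
    | tail h h' ih =>
      refine ih.tail ((hemb _ _ ?_).2 ⟨_, rfl, h'⟩)
      rintro rfl; exact ht' _ h

theorem reach_top {V : Type} [Fintype V] (S : V → V → Prop) (rk : V → ℕ)
    (h : ∀ v w, S v w → rk w < rk v) (t : V) (ht : ∀ v, (∀ u, ¬ S u v) → v = t) (v : V) (hv : v ≠ t) :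
    Relation.TransGen S t v := by
  obtain ⟨N, hN⟩ : ∃ N, ∀ v, rk v ≤ N := ⟨∑ v, rk v, fun v => Finset.single_le_sum (fun _ _ => Nat.zero_le _) (Finset.mem_univ v)⟩
  induction hn : N - rk v using Nat.strong_induction_on generalizing v with
  | _ n ih =>
    have : ∃ u, S u v := by
      by_contra! hc
      exact hv (ht v hc)
    obtain ⟨u, hu⟩ := this
    by_cases hut : u = t
    · subst hut; exact .single hu
    · have h1 := h _ _ hu
      have h2 := hN u
      exact (ih (N - rk u) (by omega) u hut rfl).tail hu

theorem mobR_emb {V V1 : Type} [Fintype V] [Fintype V1] (R : V → V → Prop) (R1 : V1 → V1 → Prop)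
    (rk : V → ℕ) (h : ∀ v w, R v w → rk w < rk v)
    (rk1 : V1 → ℕ) (h1 : ∀ v w, R1 v w → rk1 w < rk1 v)
    (emb : V1 → V) (hinj : Function.Injective emb) (t1 : V1)
    (hemb : ∀ v x, v ≠ t1 → (R (emb v) x ↔ ∃ u, x = emb u ∧ R1 v u))
    (ht : ∀ v, ¬ R1 v t1) (v w : V1) (hv : v ≠ t1) :
    mobR R (emb v) (emb w) = mobR R1 v w := by
  classical
  induction hn : rk1 v using Nat.strong_induction_on generalizing v with
  | _ n ih =>
    rw [mobR_rec R rk h, mobR_rec R1 rk1 h1]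
    simp only [hinj.eq_iff]
    congr 1
    symm
    rw [← Finset.sum_filter, ← Finset.sum_filter]
    refine Finset.sum_bij (fun a _ => emb a) ?_ ?_ ?_ ?_
    · intro a ha
      simp only [Finset.mem_filter, Finset.mem_univ, true_and] at ha ⊢
      exact (hemb _ _ hv).2 ⟨a, rfl, ha⟩
    · intro a _ b _ hab; exact hinj hab
    · intro b hb
      simp only [Finset.mem_filter, Finset.mem_univ, true_and] at hb
      obtain ⟨u, rfl, hu⟩ := (hemb _ _ hv).1 hb
      exact ⟨u, by simpa using hu, rfl⟩
    · intro a ha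
      simp only [Finset.mem_filter, Finset.mem_univ, true_and] at ha
      refine (ih (rk1 a) (hn ▸ h1 _ _ ha) a ?_ rfl).symm
      rintro rfl; exact ht _ ha

theorem sum_split {V M : Type} [Fintype V] [AddCommGroup M] (s t : V) (hst : s ≠ t)
    [Fintype {v : V // v ≠ s ∧ v ≠ t}] (f : V → M) :
    ∑ v, f v = ∑ v : {v : V // v ≠ s ∧ v ≠ t}, f v.1 + f s + f t := by
  classical
  have h1 : ∑ v : {v : V // v ≠ s ∧ v ≠ t}, f v.1 = ∑ v ∈ (Finset.univ.erase t).erase s, f v := by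
    symm
    apply Finset.sum_subtype
    simp
  rw [h1, Finset.sum_erase_add _ _ (by simp [hst]), Finset.sum_erase_add _ _ (by simp)]

theorem mobR_top {V : Type} [Fintype V] (R : V → V → Prop) (rk : V → ℕ)
    (h : ∀ v w, R v w → rk w < rk v) (s t : V) (hst : s ≠ t)
    [Fintype {v : V // v ≠ s ∧ v ≠ t}]
    (ht : ∀ v, v ≠ t → R t v) (w : V) (hw : w ≠ t) :
    mobR R t w = - ∑ u : {v : V // v ≠ s ∧ v ≠ t}, mobR R u.1 w - mobR R s w := by
  classical
  rw [mobR_rec R rk h, sum_split s t hst, if_neg hw.symm]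
  have : ¬ R t t := fun h' => lt_irrefl _ (h _ _ h')
  have h2 : ∀ u : {v : V // v ≠ s ∧ v ≠ t}, R t u.1 := fun u => ht _ u.2.2
  simp only [this, ht s hst, h2, if_true, if_false]
  ring

theorem db_aux {V1 V2 : Type} [Fintype V1] [Fintype V2] (s1 t1 : V1) (s2 t2 : V2)
    [Fintype {v : V1 // v ≠ s1 ∧ v ≠ t1}] [Fintype {v : V2 // v ≠ s2 ∧ v ≠ t2}]
    (hst1 : s1 ≠ t1) (hst2 : s2 ≠ t2)
    (R1 : V1 → V1 → Prop) (R2 : V2 → V2 → Prop)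
    (R : DbV V1 V2 s1 t1 s2 t2 → DbV V1 V2 s1 t1 s2 t2 → Prop)
    (rk1 : V1 → ℕ) (rk2 : V2 → ℕ) (d : ℕ)
    (hs1 : rk1 s1 = 0) (hs2 : rk2 s2 = 0) (ht1 : rk1 t1 = d) (ht2 : rk2 t2 = d)
    (h1 : ∀ v w, R1 v w → rk1 w < rk1 v) (h2 : ∀ v w, R2 v w → rk2 w < rk2 v)
    (h : ∀ v w, R v w → dbRk rk1 rk2 s1 t1 s2 t2 d w < dbRk rk1 rk2 s1 t1 s2 t2 d v)
    (tr1 : ∀ a b c, R1 a b → R1 b c → R1 a c) (tr2 : ∀ a b c, R2 a b → R2 b c → R2 a c)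
    (tr : ∀ a b c, R a b → R b c → R a c)
    (top1 : ∀ v, v ≠ t1 → R1 t1 v) (top2 : ∀ v, v ≠ t2 → R2 t2 v)
    (top : ∀ v, v ≠ Sum.inr true → R (Sum.inr true) v)
    (inj1 : Function.Injective (dbEmb1 s1 t1 s2 t2)) (inj2 : Function.Injective (dbEmb2 s1 t1 s2 t2))
    (emb1 : ∀ v x, v ≠ t1 → (R (dbEmb1 s1 t1 s2 t2 v) x ↔ ∃ u, x = dbEmb1 s1 t1 s2 t2 u ∧ R1 v u))
    (emb2 : ∀ v x, v ≠ t2 → (R (dbEmb2 s1 t1 s2 t2 v) x ↔ ∃ u, x = dbEmb2 s1 t1 s2 t2 u ∧ R2 v u)) :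
    ∑ v, ∑ w, mobR R v w • (PowerSeries.X : PowerSeries ℤ) ^
      (dbRk rk1 rk2 s1 t1 s2 t2 d v - dbRk rk1 rk2 s1 t1 s2 t2 d w) =
    ∑ v, ∑ w, mobR R1 v w • (PowerSeries.X : PowerSeries ℤ) ^ (rk1 v - rk1 w) +
    ∑ v, ∑ w, mobR R2 v w • (PowerSeries.X : PowerSeries ℤ) ^ (rk2 v - rk2 w) -
      (2 - (PowerSeries.X : PowerSeries ℤ) ^ d) := by
  classical
  have nt1 : ∀ v, ¬ R1 v t1 := by
    intro v hv
    by_cases hvt : v = t1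
    · subst hvt; exact lt_irrefl _ (h1 _ _ hv)
    · exact lt_asymm (h1 _ _ hv) (h1 _ _ (top1 v hvt))
  have nt2 : ∀ v, ¬ R2 v t2 := by
    intro v hv
    by_cases hvt : v = t2
    · subst hvt; exact lt_irrefl _ (h2 _ _ hv)
    · exact lt_asymm (h2 _ _ hv) (h2 _ _ (top2 v hvt))
  have nt : ∀ v, ¬ R v (Sum.inr true) := by
    intro v hv
    by_cases hvt : v = Sum.inr true
    · subst hvt; exact lt_irrefl _ (h _ _ hv)
    · exact lt_asymm (h _ _ hv) (h _ _ (top v hvt))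
  have ns1 : ∀ v, ¬ R1 s1 v := fun v hv => by have := h1 _ _ hv; omega
  have ns2 : ∀ v, ¬ R2 s2 v := fun v hv => by have := h2 _ _ hv; omega
  have ns : ∀ v, ¬ R (Sum.inr false) v := fun v hv => by
    have := h _ _ hv
    simp [dbRk] at this
  have e1s : dbEmb1 s1 t1 s2 t2 s1 = Sum.inr false := by simp [dbEmb1]
  have e2s : dbEmb2 s1 t1 s2 t2 s2 = Sum.inr false := by simp [dbEmb2]
  have e1i : ∀ i : {v : V1 // v ≠ s1 ∧ v ≠ t1}, dbEmb1 s1 t1 s2 t2 i.1 = Sum.inl (Sum.inl i) := by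
    intro i; simp [dbEmb1, i.2.1, i.2.2]
  have e2i : ∀ i : {v : V2 // v ≠ s2 ∧ v ≠ t2}, dbEmb2 s1 t1 s2 t2 i.1 = Sum.inl (Sum.inr i) := by
    intro i; simp [dbEmb2, i.2.1, i.2.2]
  have n12 : ∀ i j, ¬ R (Sum.inl (Sum.inl i)) (Sum.inl (Sum.inr j)) := by
    intro i j hij
    rw [← e1i, emb1 _ _ i.2.2] at hij
    obtain ⟨u, hu, _⟩ := hij
    unfold dbEmb1 at hu
    split_ifs at hu <;> simp at hu
  have n21 : ∀ i j, ¬ R (Sum.inl (Sum.inr j)) (Sum.inl (Sum.inl i)) := by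
    intro i j hij
    rw [← e2i, emb2 _ _ j.2.2] at hij
    obtain ⟨u, hu, _⟩ := hij
    unfold dbEmb2 at hu
    split_ifs at hu <;> simp at hu
  have m12 : ∀ i j, mobR R (Sum.inl (Sum.inl i)) (Sum.inl (Sum.inr j)) = 0 :=
    fun i j => mobR_zero R tr _ _ (by simp) (n12 i j)
  have m21 : ∀ i j, mobR R (Sum.inl (Sum.inr j)) (Sum.inl (Sum.inl i)) = 0 :=
    fun i j => mobR_zero R tr _ _ (by simp) (n21 i j)
  have mxt : ∀ x, mobR R (Sum.inl x) (Sum.inr true) = 0 :=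
    fun x => mobR_zero R tr _ _ (by simp) (nt _)
  have mst : mobR R (Sum.inr false) (Sum.inr true) = 0 :=
    mobR_zero R tr _ _ (by simp) (nt _)
  have msx : ∀ x, mobR R (Sum.inr false) (Sum.inl x) = 0 :=
    fun x => mobR_zero R tr _ _ (by simp) (ns _)
  have mself : ∀ x, mobR R x x = 1 := mobR_self R _ h tr
  have m11 : ∀ i j : {v : V1 // v ≠ s1 ∧ v ≠ t1},
      mobR R (Sum.inl (Sum.inl i)) (Sum.inl (Sum.inl j)) = mobR R1 i.1 j.1 := by
    intro i j
    rw [← e1i, ← e1i]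
    exact mobR_emb R R1 _ h _ h1 _ inj1 t1 emb1 nt1 _ _ i.2.2
  have m1s : ∀ i : {v : V1 // v ≠ s1 ∧ v ≠ t1},
      mobR R (Sum.inl (Sum.inl i)) (Sum.inr false) = mobR R1 i.1 s1 := by
    intro i
    rw [← e1i, ← e1s]
    exact mobR_emb R R1 _ h _ h1 _ inj1 t1 emb1 nt1 _ _ i.2.2
  have m22 : ∀ i j : {v : V2 // v ≠ s2 ∧ v ≠ t2},
      mobR R (Sum.inl (Sum.inr i)) (Sum.inl (Sum.inr j)) = mobR R2 i.1 j.1 := by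
    intro i j
    rw [← e2i, ← e2i]
    exact mobR_emb R R2 _ h _ h2 _ inj2 t2 emb2 nt2 _ _ i.2.2
  have m2s : ∀ i : {v : V2 // v ≠ s2 ∧ v ≠ t2},
      mobR R (Sum.inl (Sum.inr i)) (Sum.inr false) = mobR R2 i.1 s2 := by
    intro i
    rw [← e2i, ← e2s]
    exact mobR_emb R R2 _ h _ h2 _ inj2 t2 emb2 nt2 _ _ i.2.2
  have k1it : ∀ i : {v : V1 // v ≠ s1 ∧ v ≠ t1}, mobR R1 i.1 t1 = 0 :=
    fun i => mobR_zero R1 tr1 _ _ i.2.2 (nt1 _)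
  have k1si : ∀ i : {v : V1 // v ≠ s1 ∧ v ≠ t1}, mobR R1 s1 i.1 = 0 :=
    fun i => mobR_zero R1 tr1 _ _ i.2.1.symm (ns1 _)
  have k1st : mobR R1 s1 t1 = 0 := mobR_zero R1 tr1 _ _ hst1 (ns1 _)
  have k1self : ∀ x, mobR R1 x x = 1 := mobR_self R1 _ h1 tr1
  have k2it : ∀ i : {v : V2 // v ≠ s2 ∧ v ≠ t2}, mobR R2 i.1 t2 = 0 :=
    fun i => mobR_zero R2 tr2 _ _ i.2.2 (nt2 _)
  have k2si : ∀ i : {v : V2 // v ≠ s2 ∧ v ≠ t2}, mobR R2 s2 i.1 = 0 :=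
    fun i => mobR_zero R2 tr2 _ _ i.2.1.symm (ns2 _)
  have k2st : mobR R2 s2 t2 = 0 := mobR_zero R2 tr2 _ _ hst2 (ns2 _)
  have k2self : ∀ x, mobR R2 x x = 1 := mobR_self R2 _ h2 tr2
  have topl : ∀ x, R (Sum.inr true) (Sum.inl x) := fun x => top _ (by simp)
  have tops : R (Sum.inr true) (Sum.inr false) := top _ (by simp)
  have mt1 : ∀ i : {v : V1 // v ≠ s1 ∧ v ≠ t1},
      mobR R (Sum.inr true) (Sum.inl (Sum.inl i)) = mobR R1 t1 i.1 := by
    intro i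
    rw [mobR_rec R _ h, mobR_top R1 rk1 h1 s1 t1 hst1 top1 i.1 i.2.2]
    simp [Fintype.sum_sum_type, topl, tops, nt, m11, m21, msx, k1si]
  have mt2 : ∀ i : {v : V2 // v ≠ s2 ∧ v ≠ t2},
      mobR R (Sum.inr true) (Sum.inl (Sum.inr i)) = mobR R2 t2 i.1 := by
    intro i
    rw [mobR_rec R _ h, mobR_top R2 rk2 h2 s2 t2 hst2 top2 i.1 i.2.2]
    simp [Fintype.sum_sum_type, topl, tops, nt, m22, m12, msx, k2si]
  have mts : mobR R (Sum.inr true) (Sum.inr false) = mobR R1 t1 s1 + mobR R2 t2 s2 + 1 := by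
    rw [mobR_rec R _ h, mobR_top R2 rk2 h2 s2 t2 hst2 top2 _ hst2,
      mobR_top R1 rk1 h1 s1 t1 hst1 top1 _ hst1]
    simp [Fintype.sum_sum_type, topl, tops, nt, m1s, m2s, mself, k1self, k2self]
    ring
  simp only [sum_split s1 t1 hst1, sum_split s2 t2 hst2, Fintype.sum_sum_type, Fintype.sum_bool,
    m12, m21, mxt, mst, msx, mself, m11, m1s, m22, m2s, k1it, k1si, k1st, k1self, k2it, k2si, k2st,
    k2self, mt1, mt2, mts, dbRk, hs1, hs2, ht1, ht2, zero_smul, Finset.sum_const_zero, add_zero,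
    zero_add, Finset.sum_add_distrib, add_smul, one_smul, Nat.sub_zero, Nat.sub_self, pow_zero,
    if_true, if_false, Bool.false_eq_true]
  ring

theorem emb1_inj {V1 V2 : Type} (s1 t1 : V1) (s2 t2 : V2) :
    Function.Injective (dbEmb1 s1 t1 s2 t2) := by
  intro a b hab
  unfold dbEmb1 at hab
  split_ifs at hab <;> simp_all

theorem emb2_inj {V1 V2 : Type} (s1 t1 : V1) (s2 t2 : V2) :
    Function.Injective (dbEmb2 s1 t1 s2 t2) := by
  intro a b hab
  unfold dbEmb2 at hab
  split_ifs at hab <;> simp_all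

theorem emb_cross {V1 V2 : Type} (s1 t1 : V1) (s2 t2 : V2) (a : V1) (b : V2)
    (hab : dbEmb1 s1 t1 s2 t2 a = dbEmb2 s1 t1 s2 t2 b) :
    (a = s1 ∧ b = s2) ∨ (a = t1 ∧ b = t2) := by
  unfold dbEmb1 dbEmb2 at hab
  split_ifs at hab <;> simp_all

theorem hemb_aux {V V1 V2 E1 E2 : Type} (tl1 hd1 : E1 → V1) (tl2 hd2 : E2 → V2)
    (f1 : V1 → V) (f2 : V2 → V) (t1 : V1) (inj1 : Function.Injective f1)
    (hx : ∀ v e, v ≠ t1 → f2 (tl2 e) ≠ f1 v) (v : V1) (x : V) (hv : v ≠ t1) :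
    ((∃ e, f1 (tl1 e) = f1 v ∧ f1 (hd1 e) = x) ∨ (∃ e, f2 (tl2 e) = f1 v ∧ f2 (hd2 e) = x)) ↔
      ∃ u, x = f1 u ∧ ∃ e, tl1 e = v ∧ hd1 e = u := by
  constructor
  · rintro (⟨e, he, rfl⟩ | ⟨e, he, rfl⟩)
    · exact ⟨_, rfl, e, inj1 he, rfl⟩
    · exact absurd he (hx _ _ hv)
  · rintro ⟨u, rfl, e, rfl, rfl⟩
    exact Or.inl ⟨e, rfl, rfl⟩

end GLG

/-- **Proposition 5.6.** Let `Γ₁`, `Γ₂` be finite generalized layered graphs,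
each with a unique minimal vertex of rank `0` and a unique maximal vertex of rank `d ≥ 1`,
and let `Γ₁ ◊ Γ₂` be the double bouquet obtained by identifying the two minimal vertices
and the two maximal vertices.  Then
`M(Γ₁ ◊ Γ₂)(z) = M(Γ₁)(z) + M(Γ₂)(z) - (2 - z^d)`. -/
theorem MGamma_double_bouquet {V1 E1 V2 E2 : Type}
    [Fintype V1] [Fintype E1] [Fintype V2] [Fintype E2]
    (tl1 hd1 : E1 → V1) (rk1 : V1 → ℕ) (hrank1 : GLG.IsRank tl1 hd1 rk1)
    (tl2 hd2 : E2 → V2) (rk2 : V2 → ℕ) (hrank2 : GLG.IsRank tl2 hd2 rk2)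
    (d : ℕ) (hd1d : 1 ≤ d)
    (s1 : V1) (hs1 : rk1 s1 = 0) (hmin1 : ∀ v : V1, (∀ e : E1, tl1 e ≠ v) ↔ v = s1)
    (s2 : V2) (hs2 : rk2 s2 = 0) (hmin2 : ∀ v : V2, (∀ e : E2, tl2 e ≠ v) ↔ v = s2)
    (t1 : V1) (ht1 : rk1 t1 = d) (hmax1 : ∀ v : V1, (∀ e : E1, hd1 e ≠ v) ↔ v = t1)
    (t2 : V2) (ht2 : rk2 t2 = d) (hmax2 : ∀ v : V2, (∀ e : E2, hd2 e ≠ v) ↔ v = t2) :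
    GLG.MGamma (GLG.dbTl tl1 tl2 s1 t1 s2 t2) (GLG.dbHd hd1 hd2 s1 t1 s2 t2)
        (GLG.dbRk rk1 rk2 s1 t1 s2 t2 d) =
      GLG.MGamma tl1 hd1 rk1 + GLG.MGamma tl2 hd2 rk2 -
        (2 - (PowerSeries.X : PowerSeries ℤ) ^ d) := by
  classical
  have hst1 : s1 ≠ t1 := by rintro rfl; omega
  have hst2 : s2 ≠ t2 := by rintro rfl; omega
  rw [GLG.MGamma_eq, GLG.MGamma_eq, GLG.MGamma_eq]
  have r1 : ∀ v, GLG.dbRk rk1 rk2 s1 t1 s2 t2 d (GLG.dbEmb1 s1 t1 s2 t2 v) = rk1 v := by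
    intro v
    unfold GLG.dbEmb1
    split_ifs with h1 h2
    · simp [GLG.dbRk, h1, hs1]
    · simp [GLG.dbRk, h2, ht1]
    · rfl
  have r2 : ∀ v, GLG.dbRk rk1 rk2 s1 t1 s2 t2 d (GLG.dbEmb2 s1 t1 s2 t2 v) = rk2 v := by
    intro v
    unfold GLG.dbEmb2
    split_ifs with h1 h2
    · simp [GLG.dbRk, h1, hs2]
    · simp [GLG.dbRk, h2, ht2]
    · rfl
  have rk' : ∀ v w, GLG.Reaches (GLG.dbTl tl1 tl2 s1 t1 s2 t2) (GLG.dbHd hd1 hd2 s1 t1 s2 t2) v w →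
      GLG.dbRk rk1 rk2 s1 t1 s2 t2 d w < GLG.dbRk rk1 rk2 s1 t1 s2 t2 d v := by
    intro v w hvw
    rw [GLG.reaches_iff] at hvw
    refine GLG.transGen_rk _ _ ?_ hvw
    rintro _ _ ⟨e | e, rfl, rfl⟩
    · simpa [GLG.dbTl, GLG.dbHd, r1] using hrank1 e
    · simpa [GLG.dbTl, GLG.dbHd, r2] using hrank2 e
  have inj1 := GLG.emb1_inj s1 t1 s2 t2
  have inj2 := GLG.emb2_inj s1 t1 s2 t2
  have hcross := GLG.emb_cross s1 t1 s2 t2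
  have ns1 : ∀ e, tl1 e ≠ s1 := (hmin1 s1).2 rfl
  have ns2 : ∀ e, tl2 e ≠ s2 := (hmin2 s2).2 rfl
  have nt1 : ∀ e, hd1 e ≠ t1 := (hmax1 t1).2 rfl
  have nt2 : ∀ e, hd2 e ≠ t2 := (hmax2 t2).2 rfl
  have tp1 : ∀ v, v ≠ t1 → GLG.Reaches tl1 hd1 t1 v := by
    intro v hv
    rw [GLG.reaches_iff]
    refine GLG.reach_top _ rk1 (by rintro _ _ ⟨e, rfl, rfl⟩; exact hrank1 e) t1 ?_ v hv
    intro v hv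
    exact (hmax1 v).1 fun e he => hv (tl1 e) ⟨e, rfl, he⟩
  have tp2 : ∀ v, v ≠ t2 → GLG.Reaches tl2 hd2 t2 v := by
    intro v hv
    rw [GLG.reaches_iff]
    refine GLG.reach_top _ rk2 (by rintro _ _ ⟨e, rfl, rfl⟩; exact hrank2 e) t2 ?_ v hv
    intro v hv
    exact (hmax2 v).1 fun e he => hv (tl2 e) ⟨e, rfl, he⟩
  have e1t : GLG.dbEmb1 s1 t1 s2 t2 t1 = Sum.inr true := by simp [GLG.dbEmb1, hst1.symm]
  have e2t : GLG.dbEmb2 s1 t1 s2 t2 t2 = Sum.inr true := by simp [GLG.dbEmb2, hst2.symm]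
  refine GLG.db_aux s1 t1 s2 t2 hst1 hst2 _ _ _ rk1 rk2 d hs1 hs2 ht1 ht2 ?_ ?_ rk'
    ?_ ?_ ?_ tp1 tp2 ?_ inj1 inj2 ?_ ?_
  · intro v w hvw
    rw [GLG.reaches_iff] at hvw
    exact GLG.transGen_rk _ _ (by rintro _ _ ⟨e, rfl, rfl⟩; exact hrank1 e) hvw
  · intro v w hvw
    rw [GLG.reaches_iff] at hvw
    exact GLG.transGen_rk _ _ (by rintro _ _ ⟨e, rfl, rfl⟩; exact hrank2 e) hvw
  · intro a b c
    simp only [GLG.reaches_iff]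
    exact Relation.TransGen.trans
  · intro a b c
    simp only [GLG.reaches_iff]
    exact Relation.TransGen.trans
  · intro a b c
    simp only [GLG.reaches_iff]
    exact Relation.TransGen.trans
  · intro v hv
    have key1 : ∀ u, u ≠ t1 → GLG.Reaches (GLG.dbTl tl1 tl2 s1 t1 s2 t2)
        (GLG.dbHd hd1 hd2 s1 t1 s2 t2) (Sum.inr true) (GLG.dbEmb1 s1 t1 s2 t2 u) := by
      intro u hu
      have := tp1 u hu
      rw [GLG.reaches_iff] at this ⊢
      rw [← e1t]
      refine this.lift _ ?_
      rintro _ _ ⟨e, rfl, rfl⟩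
      exact ⟨Sum.inl e, rfl, rfl⟩
    have key2 : ∀ u, u ≠ t2 → GLG.Reaches (GLG.dbTl tl1 tl2 s1 t1 s2 t2)
        (GLG.dbHd hd1 hd2 s1 t1 s2 t2) (Sum.inr true) (GLG.dbEmb2 s1 t1 s2 t2 u) := by
      intro u hu
      have := tp2 u hu
      rw [GLG.reaches_iff] at this ⊢
      rw [← e2t]
      refine this.lift _ ?_
      rintro _ _ ⟨e, rfl, rfl⟩
      exact ⟨Sum.inr e, rfl, rfl⟩
    rcases v with (v | v) | b
    · simpa [GLG.dbEmb1, v.2.1, v.2.2] using key1 v.1 v.2.2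
    · simpa [GLG.dbEmb2, v.2.1, v.2.2] using key2 v.1 v.2.2
    · have hb : b = false := by
        cases b
        · rfl
        · exact absurd rfl hv
      subst hb
      simpa [GLG.dbEmb1] using key1 s1 hst1
  · intro v x hv
    simp only [GLG.reaches_iff]
    refine GLG.reach_emb _ _ _ t1 ?_ ?_ v hv x
    · intro v x hv
      rw [Sum.exists]
      refine GLG.hemb_aux tl1 hd1 tl2 hd2 (GLG.dbEmb1 s1 t1 s2 t2) (GLG.dbEmb2 s1 t1 s2 t2) t1 inj1 ?_ v x hv
      intro v e hv he
      rcases hcross _ _ he.symm with h | h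
      · exact ns2 _ h.2
      · exact hv h.1
    · rintro v ⟨e, _, he⟩
      exact nt1 e he
  · intro v x hv
    simp only [GLG.reaches_iff]
    refine GLG.reach_emb _ _ _ t2 ?_ ?_ v hv x
    · intro v x hv
      rw [Sum.exists, or_comm]
      refine GLG.hemb_aux tl2 hd2 tl1 hd1 (GLG.dbEmb2 s1 t1 s2 t2) (GLG.dbEmb1 s1 t1 s2 t2) t2 inj2 ?_ v x hv
      intro v e hv he
      rcases hcross _ _ he with h | h
      · exact ns1 _ h.1
      · exact hv h.2
    · rintro v ⟨e, _, he⟩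
      exact nt2 e he
end

section
/- Let Γ_1 and Γ_2 be finite generalized layered graphs, each with a unique minimal vertex of rank 0 and a unique maximal vertex of rank d (with d ≥ 1), and let Γ_1 ◊ Γ_2 be the double bouquet obtained from the disjoint union of Γ_1 and Γ_2 by identifying the two minimal vertices with each other and the two maximal vertices with each other. Then, in the ring of formal power series over ℤ (where each Hilbert series has constant term 1 and hence is invertible), H(A(Γ_1 ◊ Γ_2),z)^{−1} = H(A(Γ_1),z)^{−1} + H(A(Γ_2),z)^{−1} − (1 − z − z^2 − ⋯ − z^d); here 1 − z − z^2 − ⋯ − z^d = H(A(Δ(d)),z)^{−1}, where Δ(d) is the generalized layered graph with two vertices of ranks d and 0 and a single edge from the first to the second. -/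
open scoped BigOperators

namespace DB
open PowerSeries

section gen
variable {R : Type} [Ring R]

def DegLE (f : PowerSeries R) (n : ℕ) : Prop := ∀ m, n < m → coeff m f = 0

noncomputable def tr (k : ℕ) (f : PowerSeries R) : PowerSeries R :=
  PowerSeries.mk fun n => if n ≤ k then coeff n f else 0

noncomputable def sh (k : ℕ) (f : PowerSeries R) : PowerSeries R :=
  PowerSeries.mk fun n => coeff (n + k) f

noncomputable def nv (f : PowerSeries R) : PowerSeries R := invOfUnit f 1

lemma mul_nv {f : PowerSeries R} (h : coeff 0 f = 1) : f * nv f = 1 :=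
  mul_invOfUnit f 1 (by simpa using h)

lemma nv_mul {f : PowerSeries R} (h : coeff 0 f = 1) : nv f * f = 1 :=
  invOfUnit_mul f 1 (by simpa using h)

lemma X_pow_mul_sh {k : ℕ} {f : PowerSeries R} (h : ∀ i < k, coeff i f = 0) :
    X ^ k * sh k f = f := by
  ext n
  rw [coeff_X_pow_mul']
  split_ifs with hn
  · simp [sh, Nat.sub_add_cancel hn]
  · exact (h n (by omega)).symm

lemma DegLE.mul {f g : PowerSeries R} {a b : ℕ} (hf : DegLE f a) (hg : DegLE g b) :
    DegLE (f * g) (a + b) := by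
  intro m hm
  rw [coeff_mul]
  refine Finset.sum_eq_zero fun p hp => ?_
  have := Finset.HasAntidiagonal.mem_antidiagonal.1 hp
  rcases lt_or_ge a p.1 with h | h
  · rw [hf _ h, zero_mul]
  · rw [hg _ (by omega), mul_zero]

lemma DegLE.mono {f : PowerSeries R} {a b : ℕ} (hf : DegLE f a) (h : a ≤ b) : DegLE f b :=
  fun m hm => hf m (by omega)

lemma DegLE.sub {f g : PowerSeries R} {a : ℕ} (hf : DegLE f a) (hg : DegLE g a) :
    DegLE (f - g) a := fun m hm => by rw [map_sub, hf m hm, hg m hm, sub_zero]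

lemma DegLE.tr_eq {f : PowerSeries R} {a : ℕ} (hf : DegLE f a) : tr a f = f := by
  ext n
  simp only [tr, coeff_mk]
  split_ifs with h
  · rfl
  · exact (hf n (by omega)).symm

lemma degLE_C (a : R) : DegLE (C a) 0 := fun m hm => by
  rw [coeff_C, if_neg (by omega)]

variable {F : Type} [Field F] [Algebra F R]

lemma mul_mem_series {P : ℕ → Submodule F R} {f A : PowerSeries R}
    (hc : ∀ i j, ∀ x ∈ P i, x * coeff j A ∈ P (i + j)) (hf : ∀ i, coeff i f ∈ P i) (i : ℕ) :
    coeff i (f * A) ∈ P i := by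
  rw [coeff_mul]
  refine Submodule.sum_mem _ fun p hp => ?_
  have := Finset.HasAntidiagonal.mem_antidiagonal.1 hp
  rw [← this]
  exact hc _ _ _ (hf _)

lemma quot_mem_series {P : ℕ → Submodule F R} {f g A : PowerSeries R} (hA : coeff 0 A = 1)
    (h : g * A = f)
    (hc : ∀ i j, ∀ x ∈ P i, x * coeff j A ∈ P (i + j)) (hf : ∀ i, coeff i f ∈ P i) (i : ℕ) :
    coeff i g ∈ P i := by
  induction i using Nat.strong_induction_on with
  | _ i ih =>
    have h1 : coeff i f = coeff i (g * A) := by rw [h]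
    have hm : ((i, 0) : ℕ × ℕ) ∈ Finset.HasAntidiagonal.antidiagonal i := by simp
    rw [coeff_mul, ← Finset.add_sum_erase _ _ hm] at h1
    simp only [hA, mul_one] at h1
    rw [eq_comm, ← eq_sub_iff_add_eq] at h1
    rw [h1]
    refine Submodule.sub_mem _ (hf i) (Submodule.sum_mem _ fun p hp => ?_)
    obtain ⟨hne, hp⟩ := Finset.mem_erase.1 hp
    have hp := Finset.HasAntidiagonal.mem_antidiagonal.1 hp
    have : p.1 < i := by
      rcases Nat.lt_or_ge p.1 i with h | h
      · exact h
      · exact absurd (Prod.ext (by simp; omega) (by simp; omega)) hne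
    have h2 := hc _ p.2 _ (ih _ this)
    rwa [hp] at h2

end gen

section stR
variable {F T : Type} [Field F] [Ring T] [Algebra F T]

noncomputable def stR (q : PowerSeries T) (Φ : PowerSeries (Module.End F T)ᵐᵒᵖ) : PowerSeries T :=
  PowerSeries.mk fun n => ∑ p ∈ Finset.HasAntidiagonal.antidiagonal n, (coeff p.2 Φ).unop (coeff p.1 q)

lemma coeff_stR (q : PowerSeries T) (Φ : PowerSeries (Module.End F T)ᵐᵒᵖ) (n : ℕ) :
    coeff n (stR q Φ) = ∑ p ∈ Finset.HasAntidiagonal.antidiagonal n, (coeff p.2 Φ).unop (coeff p.1 q) := by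
  simp [stR]

lemma stR_add (p q : PowerSeries T) (Φ : PowerSeries (Module.End F T)ᵐᵒᵖ) :
    stR (p + q) Φ = stR p Φ + stR q Φ := by
  ext n; simp [coeff_stR, Finset.sum_add_distrib]

lemma coeff_stR_C (m : T) (Φ : PowerSeries (Module.End F T)ᵐᵒᵖ) (n : ℕ) :
    coeff n (stR (C m) Φ) = (coeff n Φ).unop m := by
  rw [coeff_stR, Finset.sum_eq_single (0, n)]
  · simp
  · intro p hp hne
    have := Finset.HasAntidiagonal.mem_antidiagonal.1 hp
    have h0 : p.1 ≠ 0 := fun h => hne (Prod.ext h (by simp; omega))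
    rw [coeff_C, if_neg h0, map_zero]
  · intro h; simp at h

lemma stR_X_mul (q : PowerSeries T) (Φ : PowerSeries (Module.End F T)ᵐᵒᵖ) :
    stR (X * q) Φ = X * stR q Φ := by
  ext n
  cases n with
  | zero => simp [coeff_stR]
  | succ n =>
    rw [coeff_succ_X_mul, coeff_stR, coeff_stR, Finset.Nat.sum_antidiagonal_succ]
    simp [coeff_succ_X_mul]

lemma stR_X_pow_mul (k : ℕ) (q : PowerSeries T) (Φ : PowerSeries (Module.End F T)ᵐᵒᵖ) :
    stR (X ^ k * q) Φ = X ^ k * stR q Φ := by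
  induction k with
  | zero => simp
  | succ k ih => rw [pow_succ', mul_assoc, stR_X_mul, ih, mul_assoc]

lemma stR_stR (q : PowerSeries T) (Φ Ψ : PowerSeries (Module.End F T)ᵐᵒᵖ) :
    stR (stR q Φ) Ψ = stR q (Φ * Ψ) := by
  ext n
  simp only [coeff_stR, coeff_mul, map_sum, Finset.unop_sum, LinearMap.sum_apply,
    MulOpposite.unop_mul, Module.End.mul_apply]
  rw [Finset.sum_sigma', Finset.sum_sigma']
  refine Finset.sum_nbij' (fun x => ⟨(x.2.1, x.2.2 + x.1.2), (x.2.2, x.1.2)⟩)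
    (fun x => ⟨(x.1.1 + x.2.1, x.2.2), (x.1.1, x.2.1)⟩) ?_ ?_ ?_ ?_ ?_
  · rintro ⟨⟨a, b⟩, ⟨c, e⟩⟩ h
    simp at h ⊢; omega
  · rintro ⟨⟨a, b⟩, ⟨c, e⟩⟩ h
    simp at h ⊢; omega
  · rintro ⟨⟨a, b⟩, ⟨c, e⟩⟩ h
    simp at h ⊢
    obtain ⟨h1, h2⟩ := h
    subst h2; rfl
  · rintro ⟨⟨a, b⟩, ⟨c, e⟩⟩ h
    simp at h ⊢
    obtain ⟨h1, h2⟩ := h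
    subst h2; rfl
  · rintro ⟨⟨a, b⟩, ⟨c, e⟩⟩ h
    rfl

lemma stR_one (q : PowerSeries T) : stR (F := F) q 1 = q := by
  ext n
  rw [coeff_stR, Finset.sum_eq_single (n, 0)]
  · simp
  · intro p hp hne
    have := Finset.HasAntidiagonal.mem_antidiagonal.1 hp
    have h0 : p.2 ≠ 0 := fun h => hne (Prod.ext (by simp; omega) h)
    rw [coeff_one, if_neg h0]; simp
  · intro h; simp at h

lemma stR_degLE {q : PowerSeries T} {Φ : PowerSeries (Module.End F T)ᵐᵒᵖ} {a b : ℕ}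
    (hq : DegLE q a) (h : ∀ i j, b < j → (coeff j Φ).unop (coeff i q) = 0) :
    DegLE (stR q Φ) (a + b) := by
  intro m hm
  rw [coeff_stR]
  refine Finset.sum_eq_zero fun p hp => ?_
  have := Finset.HasAntidiagonal.mem_antidiagonal.1 hp
  rcases lt_or_ge a p.1 with h' | h'
  · rw [hq _ h', map_zero]
  · exact h _ _ (by omega)

end stR
end DB

namespace DB
open PowerSeries

section words
variable (F : Type) [Field F] {V : Type} (rk : V → ℕ) (gt : V → V → Prop)

abbrev TT (F V : Type) [Field F] : Type := FreeAlgebra F (V × ℕ)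

noncomputable def ltr (v : V) (k : ℕ) : TT F V :=
  if k = 0 then 1 else if k ≤ rk v then FreeAlgebra.ι F (v, k) else 0

noncomputable def As (v : V) : PowerSeries (TT F V) := PowerSeries.mk (ltr F rk v)

noncomputable def word : List (V × ℕ) → TT F V
  | [] => 1
  | l :: u => word u * FreeAlgebra.ι F l

def cov (l : V × ℕ) (w : V) : Prop := gt l.1 w ∧ l.2 + rk w = rk l.1

def NC (m : List (V × ℕ)) (w : V) : Prop := ∀ l ∈ m.head?, ¬ cov rk gt l w

def Nrm : List (V × ℕ) → Prop
  | [] => True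
  | l :: u => (1 ≤ l.2 ∧ l.2 ≤ rk l.1) ∧ Nrm u ∧ NC rk gt u l.1

def dg (m : List (V × ℕ)) : ℕ := (m.map Prod.snd).sum

noncomputable def SS (w : V) (n : ℕ) : Submodule F (TT F V) :=
  Submodule.span F {x | ∃ m, Nrm rk gt m ∧ NC rk gt m w ∧ dg m = n ∧ x = word F m}

noncomputable def E' (l : V × ℕ) (u : List (V × ℕ)) (w : V) (r : PowerSeries (TT F V)) :
    PowerSeries (TT F V) :=
  tr l.2 ((C (word F u) * As F rk l.1 - r) * nv (As F rk w)) - X ^ l.2 * C (word F (l :: u))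

open Classical in
noncomputable def Rw (w : V) : List (V × ℕ) → PowerSeries (TT F V)
  | [] => As F rk w
  | l :: u => if cov rk gt l w then
      sh l.2 (C (word F u) * As F rk l.1 - Rw w u - E' F rk l u w (Rw w u) * As F rk w)
    else C (word F (l :: u)) * As F rk w

variable {F rk gt}

lemma coeff_As (v : V) (k : ℕ) : coeff k (As F rk v) = ltr F rk v k := by simp [As]
lemma coeff_As_zero (v : V) : coeff 0 (As F rk v) = 1 := by simp [As, ltr]
lemma As_deg (v : V) : DegLE (As F rk v) (rk v) := fun m hm => by
  rw [coeff_As, ltr, if_neg (by omega), if_neg (by omega)]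

lemma Rw_nc {w : V} {m : List (V × ℕ)} (h : NC rk gt m w) :
    Rw F rk gt w m = C (word F m) * As F rk w := by
  cases m with
  | nil => simp [Rw, word]
  | cons l u => rw [Rw, if_neg (h l (by simp))]

lemma Rw_cov {w : V} {l : V × ℕ} {u : List (V × ℕ)} (h : cov rk gt l w) :
    X ^ l.2 * Rw F rk gt w (l :: u) = C (word F u) * As F rk l.1 - Rw F rk gt w u
      - E' F rk l u w (Rw F rk gt w u) * As F rk w := by
  rw [Rw, if_pos h]
  apply X_pow_mul_sh
  intro i hi
  set Y := C (word F u) * As F rk l.1 - Rw F rk gt w u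
  set Z := Y * nv (As F rk w) with hZ
  have hY : Y = Z * As F rk w := by
    rw [hZ, mul_assoc, nv_mul (coeff_As_zero w), mul_one]
  have : Y - E' F rk l u w (Rw F rk gt w u) * As F rk w =
      (Z - tr l.2 Z + X ^ l.2 * C (word F (l :: u))) * As F rk w := by
    rw [hY, E', ← hZ]; noncomm_ring
  rw [this, coeff_mul]
  refine Finset.sum_eq_zero fun p hp => ?_
  have := Finset.HasAntidiagonal.mem_antidiagonal.1 hp
  have h1 : coeff p.1 (Z - tr l.2 Z + X ^ l.2 * C (word F (l :: u))) = 0 := by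
    rw [map_add, map_sub, coeff_X_pow_mul', if_neg (by omega)]
    simp [tr, show p.1 ≤ l.2 by omega]
  rw [h1, zero_mul]

lemma coeff_Rw_zero {w : V} (m : List (V × ℕ)) : coeff 0 (Rw F rk gt w m) = word F m := by
  cases m with
  | nil => simp only [Rw, word, coeff_As_zero]
  | cons l u =>
    by_cases h : cov rk gt l w
    · rw [Rw, if_pos h]
      set Y := C (word F u) * As F rk l.1 - Rw F rk gt w u
      set Z := Y * nv (As F rk w) with hZ
      have hY : Y = Z * As F rk w := by
        rw [hZ, mul_assoc, nv_mul (coeff_As_zero w), mul_one]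
      have : Y - E' F rk l u w (Rw F rk gt w u) * As F rk w =
          (Z - tr l.2 Z + X ^ l.2 * C (word F (l :: u))) * As F rk w := by
        rw [hY, E', ← hZ]; noncomm_ring
      rw [this]
      simp only [sh, coeff_mk, zero_add]
      rw [coeff_mul, Finset.sum_eq_single (l.2, 0)]
      · rw [map_add, map_sub, coeff_X_pow_mul', if_pos le_rfl]
        simp [tr, coeff_As, ltr]
      · intro p hp hne
        have := Finset.HasAntidiagonal.mem_antidiagonal.1 hp
        have h0 : p.2 ≠ 0 := fun h => hne (Prod.ext (by simp; omega) h)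
        have h1 : coeff p.1 (Z - tr l.2 Z + X ^ l.2 * C (word F (l :: u))) = 0 := by
          rw [map_add, map_sub, coeff_X_pow_mul', if_neg (by omega)]
          simp [tr, show p.1 ≤ l.2 by omega]
        rw [h1, zero_mul]
      · intro h; simp at h
    · rw [Rw, if_neg h]; rw [coeff_C_mul, coeff_As_zero, mul_one]

section
variable (hgt : ∀ v w, gt v w → rk w < rk v)
include hgt

lemma SS_mul_ltr {w : V} {n : ℕ} {x : TT F V} (hx : x ∈ SS F rk gt w n) (j : ℕ) :
    x * ltr F rk w j ∈ SS F rk gt w (n + j) := by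
  unfold ltr
  split_ifs with h1 h2
  · subst h1; simpa using hx
  · induction hx using Submodule.span_induction with
    | mem x hx =>
      obtain ⟨m, hm, hnc, hd, rfl⟩ := hx
      refine Submodule.subset_span ⟨(w, j) :: m, ⟨⟨by simp; omega, h2⟩, hm, hnc⟩, ?_, ?_, rfl⟩
      · intro l hl
        simp at hl; subst hl
        intro h
        exact absurd (hgt _ _ h.1) (by simp)
      · simp [dg] at hd ⊢; omega
    | zero => simp
    | add x y _ _ hx hy => rw [add_mul]; exact Submodule.add_mem _ hx hy
    | smul a x _ hx => rw [smul_mul_assoc]; exact Submodule.smul_mem _ _ hx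
  · simp

lemma SS_word_ltr {u : List (V × ℕ)} {x w : V} {j : ℕ} (hu : Nrm rk gt u) (hnc : NC rk gt u x)
    (hj : 1 ≤ j) (hc : ¬ cov rk gt (x, j) w) :
    word F u * ltr F rk x j ∈ SS F rk gt w (dg u + j) := by
  unfold ltr
  rw [if_neg (by omega)]
  split_ifs with h2
  · refine Submodule.subset_span ⟨(x, j) :: u, ⟨⟨hj, h2⟩, hu, hnc⟩, ?_, ?_, rfl⟩
    · intro l hl
      simp at hl; subst hl
      exact hc
    · simp [dg]; omega
  · simp

lemma E'_mem {l : V × ℕ} {u : List (V × ℕ)} {w : V} {r : PowerSeries (TT F V)}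
    (hn : Nrm rk gt (l :: u)) (hc : cov rk gt l w) (h0 : coeff 0 r = word F u)
    (hr : ∀ j, 1 ≤ j → coeff j r ∈ SS F rk gt w (dg u + j)) (i : ℕ) :
    coeff i (E' F rk l u w r) ∈ SS F rk gt w (dg u + i) := by
  obtain ⟨⟨hl1, hl2⟩, hu, hnc⟩ := hn
  set g := (C (word F u) * As F rk l.1 - r) * nv (As F rk w) - X ^ l.2 * C (word F (l :: u))
    with hg
  -- all coefficients up to `l.2` lie in the right place
  have key : ∀ i, coeff i (tr l.2 g) ∈ SS F rk gt w (dg u + i) := by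
    intro i
    induction i using Nat.strong_induction_on with
    | _ i ih =>
      simp only [tr, coeff_mk]
      split_ifs with hi
      · have h1 : g * As F rk w = C (word F u) * As F rk l.1 - r
            - X ^ l.2 * C (word F (l :: u)) * As F rk w := by
          rw [hg, sub_mul, mul_assoc _ (nv _), nv_mul (coeff_As_zero w), mul_one]
        have h2 : coeff i (g * As F rk w) ∈ SS F rk gt w (dg u + i) := by
          rw [h1]
          simp only [map_sub, coeff_C_mul, coeff_As, mul_assoc, coeff_X_pow_mul']
          rcases Nat.eq_zero_or_pos i with h | h
          · subst h
            rw [if_neg (by omega), h0]; simp [ltr]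
          · rcases Nat.lt_or_ge i l.2 with h' | h'
            · rw [if_neg (by omega), sub_zero]
              refine Submodule.sub_mem _ (SS_word_ltr hgt hu hnc h ?_) (hr i h)
              rintro ⟨-, h3⟩
              have := hc.2
              simp at h3; omega
            · have : i = l.2 := le_antisymm hi h'
              subst this
              rw [if_pos le_rfl]
              have : word F u * ltr F rk l.1 l.2 = word F (l :: u) := by
                rw [ltr, if_neg (by omega), if_pos hl2]; rfl
              have h00 : ltr F rk w 0 = 1 := by simp [ltr]
              rw [this, Nat.sub_self, h00, mul_one]
              have h4 := Submodule.neg_mem _ (hr l.2 h)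
              convert h4 using 1
              abel
        have hm : ((i, 0) : ℕ × ℕ) ∈ Finset.HasAntidiagonal.antidiagonal i := by simp
        rw [coeff_mul, ← Finset.add_sum_erase _ _ hm] at h2
        simp only [coeff_As_zero, mul_one] at h2
        refine (Submodule.add_mem_iff_left _ (Submodule.sum_mem _ fun p hp => ?_)).1 h2
        obtain ⟨hne, hp⟩ := Finset.mem_erase.1 hp
        have hp := Finset.HasAntidiagonal.mem_antidiagonal.1 hp
        have hlt : p.1 < i := by
          rcases Nat.lt_or_ge p.1 i with h | h
          · exact h
          · exact absurd (Prod.ext (by simp; omega) (by simp; omega)) hne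
        have h5 := ih _ hlt
        simp only [tr, coeff_mk, if_pos (show p.1 ≤ l.2 by omega)] at h5
        rw [coeff_As]
        have h6 := SS_mul_ltr hgt h5 p.2
        rwa [add_assoc, hp] at h6
      · exact Submodule.zero_mem _
  have : E' F rk l u w r = tr l.2 g := by
    ext n
    rw [E', hg]
    simp only [tr, coeff_mk, map_sub, coeff_X_pow_mul']
    split_ifs
    · rfl
    · rfl
    · have : n - l.2 ≠ 0 := by omega
      rw [coeff_C, if_neg this]; simp
    · omega
  rw [this]; exact key i

omit hgt in
lemma E'_deg {l : V × ℕ} {u : List (V × ℕ)} {w : V} {r : PowerSeries (TT F V)} :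
    DegLE (E' F rk l u w r) l.2 := by
  intro m hm
  rw [E']
  simp only [tr, map_sub, coeff_mk, if_neg (show ¬ m ≤ l.2 by omega), coeff_X_pow_mul',
    if_pos hm.le, coeff_C, if_neg (show ¬ m - l.2 = 0 by omega), sub_zero]

lemma SS_mul_As {w : V} {n : ℕ} {f : PowerSeries (TT F V)}
    (hf : ∀ i, coeff i f ∈ SS F rk gt w (n + i)) (i : ℕ) :
    coeff i (f * As F rk w) ∈ SS F rk gt w (n + i) := by
  refine mul_mem_series (P := fun i => SS F rk gt w (n + i)) ?_ hf i
  intro i j x hx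
  rw [coeff_As, ← add_assoc]
  exact SS_mul_ltr hgt hx j

lemma Rw_mem {w : V} {m : List (V × ℕ)} (hm : Nrm rk gt m) (j : ℕ) (hj : 1 ≤ j) :
    coeff j (Rw F rk gt w m) ∈ SS F rk gt w (dg m + j) := by
  induction m generalizing j with
  | nil =>
    rw [Rw_nc (fun l hl => by simp at hl), coeff_C_mul, coeff_As]
    refine SS_mul_ltr hgt (Submodule.subset_span ⟨[], trivial, fun l hl => by simp at hl, rfl, rfl⟩) j
  | cons l u ih =>
    by_cases h : cov rk gt l w
    · obtain ⟨⟨hl1, hl2⟩, hu, hnc⟩ := hm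
      have h1 := congrArg (coeff (j + l.2)) (Rw_cov (F := F) (u := u) h)
      rw [coeff_X_pow_mul] at h1
      rw [h1, map_sub, map_sub, coeff_C_mul, coeff_As]
      have e : dg (l :: u) + j = dg u + (j + l.2) := by simp [dg]; omega
      rw [e]
      refine Submodule.sub_mem _ (Submodule.sub_mem _ ?_ (ih hu _ (by omega))) ?_
      · refine SS_word_ltr hgt hu hnc (by omega) ?_
        rintro ⟨-, h3⟩
        have := h.2
        simp at h3; omega
      · exact SS_mul_As hgt (E'_mem hgt ⟨⟨hl1, hl2⟩, hu, hnc⟩ h (coeff_Rw_zero u)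
          (fun j hj => ih hu j hj)) _
    · have hnc : NC rk gt (l :: u) w := fun l' hl' => by simp at hl'; subst hl'; exact h
      rw [Rw_nc hnc, coeff_C_mul, coeff_As]
      exact SS_mul_ltr hgt (Submodule.subset_span ⟨_, hm, hnc, rfl, rfl⟩) j

omit hgt in
lemma Rw_deg {w : V} (m : List (V × ℕ)) : DegLE (Rw F rk gt w m) (rk w) := by
  induction m with
  | nil => exact As_deg w
  | cons l u ih =>
    by_cases h : cov rk gt l w
    · intro n hn
      have h1 := congrArg (coeff (n + l.2)) (Rw_cov (F := F) (u := u) h)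
      rw [coeff_X_pow_mul] at h1
      rw [h1]
      have h2 := h.2
      have h3 : DegLE (C (word F u) * As F rk l.1) (0 + rk l.1) := (degLE_C _).mul (As_deg _)
      have h4 : DegLE (E' F rk l u w (Rw F rk gt w u) * As F rk w) (l.2 + rk w) :=
        E'_deg.mul (As_deg _)
      rw [map_sub, map_sub, h3 _ (by omega), ih _ (by omega), h4 _ (by omega)]; simp
    · rw [Rw, if_neg h]
      have h3 : DegLE (C (word F (l :: u)) * As F rk w) (0 + rk w) := (degLE_C _).mul (As_deg _)
      rwa [zero_add] at h3

end
end words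
end DB

namespace DB
open PowerSeries

section ops
variable (F : Type) [Field F] {V : Type} (rk : V → ℕ) (gt : V → V → Prop)

noncomputable def bas : Module.Basis (List (V × ℕ)) F (TT F V) :=
  (FreeAlgebra.basisFreeMonoid F (V × ℕ)).reindex
    (⟨fun m => (FreeMonoid.toList m).reverse, fun m => FreeMonoid.ofList m.reverse,
      fun m => by simp, fun m => by simp⟩ : FreeMonoid (V × ℕ) ≃ List (V × ℕ))

lemma bas_apply (m : List (V × ℕ)) : bas F m = word F m := by
  have h : ∀ m : FreeMonoid (V × ℕ), FreeAlgebra.basisFreeMonoid F (V × ℕ) m =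
      FreeMonoid.lift (FreeAlgebra.ι F) m := by
    intro m
    simp [FreeAlgebra.basisFreeMonoid, FreeAlgebra.equivMonoidAlgebraFreeMonoid]
  rw [bas, Module.Basis.reindex_apply, h]
  induction m with
  | nil => simp [word]
  | cons l u ih =>
    simp only [Equiv.coe_fn_symm_mk] at ih ⊢
    rw [List.reverse_cons, FreeMonoid.ofList_append, map_mul, ih, word]
    simp

open Classical in
noncomputable def Rop (w : V) (j : ℕ) : Module.End F (TT F V) :=
  (bas F).constr F fun m => if Nrm rk gt m then coeff j (Rw F rk gt w m)
    else if j = 0 then word F m else 0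

noncomputable def rho (w : V) : PowerSeries (Module.End F (TT F V))ᵐᵒᵖ :=
  PowerSeries.mk fun j => MulOpposite.op (Rop F rk gt w j)

variable {F rk gt}

lemma ext_word {f g : Module.End F (TT F V)} (h : ∀ m, f (word F m) = g (word F m)) : f = g :=
  (bas F).ext fun m => by rw [bas_apply]; exact h m

lemma Rop_nrm {w : V} {j : ℕ} {m : List (V × ℕ)} (h : Nrm rk gt m) :
    Rop F rk gt w j (word F m) = coeff j (Rw F rk gt w m) := by
  rw [Rop, ← bas_apply, Module.Basis.constr_basis, if_pos h]

lemma Rop_not {w : V} {j : ℕ} {m : List (V × ℕ)} (h : ¬ Nrm rk gt m) :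
    Rop F rk gt w j (word F m) = if j = 0 then word F m else 0 := by
  rw [Rop, ← bas_apply, Module.Basis.constr_basis, if_neg h, bas_apply]

lemma rho_zero (w : V) : coeff 0 (rho F rk gt w) = 1 := by
  rw [rho, coeff_mk]
  apply MulOpposite.unop_injective
  refine ext_word fun m => ?_
  by_cases h : Nrm rk gt m
  · simp [Rop_nrm h, coeff_Rw_zero]
  · simp [Rop_not h]

lemma coeff_rho (w : V) (j : ℕ) : (coeff j (rho F rk gt w)).unop = Rop F rk gt w j := by
  simp [rho]

lemma stR_rho_nrm {w : V} {m : List (V × ℕ)} (h : Nrm rk gt m) :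
    stR (C (word F m)) (rho F rk gt w) = Rw F rk gt w m := by
  ext n; rw [coeff_stR_C, coeff_rho, Rop_nrm h]

lemma stR_rho_not {w : V} {m : List (V × ℕ)} (h : ¬ Nrm rk gt m) :
    stR (C (word F m)) (rho F rk gt w) = C (word F m) := by
  ext n; rw [coeff_stR_C, coeff_rho, Rop_not h, coeff_C]

lemma Rop_SS {w : V} {n j : ℕ} {x : TT F V} (hx : x ∈ SS F rk gt w n) :
    Rop F rk gt w j x = x * ltr F rk w j := by
  induction hx using Submodule.span_induction with
  | mem x hx =>
    obtain ⟨m, hm, hnc, hd, rfl⟩ := hx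
    rw [Rop_nrm hm, Rw_nc hnc, coeff_C_mul, coeff_As]
  | zero => simp
  | add x y _ _ hx hy => rw [add_mul, map_add, hx, hy]
  | smul a x _ hx => rw [smul_mul_assoc, map_smul, hx]

lemma stR_rho_SS {w : V} {q : PowerSeries (TT F V)}
    (h : ∀ i, ∃ n, coeff i q ∈ SS F rk gt w n) : stR q (rho F rk gt w) = q * As F rk w := by
  ext n
  rw [coeff_stR, coeff_mul]
  refine Finset.sum_congr rfl fun p hp => ?_
  obtain ⟨k, hk⟩ := h p.1
  rw [coeff_rho, Rop_SS hk, coeff_As]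

noncomputable def EE (F : Type) [Field F] (rk : V → ℕ) (gt : V → V → Prop) (l : V × ℕ)
    (u : List (V × ℕ)) (w : V) : PowerSeries (TT F V) :=
  C (word F u) + E' F rk l u w (Rw F rk gt w u) + X ^ l.2 * C (word F (l :: u))

lemma stR_EE (hgt : ∀ v w, gt v w → rk w < rk v) {l : V × ℕ} {u : List (V × ℕ)} {w : V}
    (hn : Nrm rk gt (l :: u)) (hc : cov rk gt l w) :
    stR (EE F rk gt l u w) (rho F rk gt w) = C (word F u) * As F rk l.1 := by
  rw [EE, stR_add, stR_add, stR_X_pow_mul, stR_rho_nrm hn, stR_rho_nrm hn.2.1, Rw_cov hc,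
    stR_rho_SS]
  · abel
  · intro i
    exact ⟨_, E'_mem hgt hn hc (coeff_Rw_zero u) (fun j hj => Rw_mem hgt hn.2.1 j hj) i⟩

lemma EE_deg {l : V × ℕ} {u : List (V × ℕ)} {w : V} : DegLE (EE F rk gt l u w) l.2 := by
  intro m hm
  rw [EE, map_add, map_add, E'_deg _ hm, degLE_C _ _ (by omega), coeff_X_pow_mul',
    if_pos hm.le, degLE_C _ _ (by omega)]
  simp

lemma key2 (hgt : ∀ v w, gt v w → rk w < rk v) {x w : V} {u : List (V × ℕ)}
    (hu : Nrm rk gt u) (hnc : NC rk gt u x) (hg : gt x w) :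
    DegLE (stR (C (word F u) * As F rk x) (nv (rho F rk gt w))) (rk x - rk w) := by
  have h1 := hgt _ _ hg
  have hn : Nrm rk gt ((x, rk x - rk w) :: u) := ⟨⟨by simp; omega, by simp⟩, hu, hnc⟩
  have hc : cov rk gt (x, rk x - rk w) w := ⟨hg, by simp; omega⟩
  have h2 := stR_EE (F := F) hgt hn hc
  simp only at h2
  rw [← h2, stR_stR, mul_nv (rho_zero w), stR_one]
  exact EE_deg

lemma key3 (hgt : ∀ v w, gt v w → rk w < rk v) (htr : ∀ u v w, gt u v → gt v w → gt u w)
    {v w : V} (hg : gt v w) (m : List (V × ℕ)) :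
    DegLE (stR (C (word F m)) (rho F rk gt v * nv (rho F rk gt w))) (rk v - rk w) := by
  induction m with
  | nil =>
    have hn : Nrm rk gt ([] : List (V × ℕ)) := trivial
    have hnc : NC rk gt ([] : List (V × ℕ)) v := fun l hl => by simp at hl
    rw [← stR_stR, stR_rho_nrm hn, Rw_nc hnc]
    exact key2 hgt hn hnc hg
  | cons l u ih =>
    by_cases hn : Nrm rk gt (l :: u)
    · by_cases hc : cov rk gt l v
      · have hSS : ∀ n, ∀ x ∈ SS F rk gt v n, ∀ j, rk v - rk w < j →
            (coeff j (rho F rk gt v * nv (rho F rk gt w))).unop x = 0 := by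
          intro n x hx j hj
          induction hx using Submodule.span_induction with
          | mem x hx =>
            obtain ⟨m, hm, hnc, hd, rfl⟩ := hx
            rw [← coeff_stR_C, ← stR_stR, stR_rho_nrm hm, Rw_nc hnc]
            exact key2 hgt hm hnc hg _ hj
          | zero => simp
          | add x y _ _ hx hy => rw [map_add, hx, hy, add_zero]
          | smul a x _ hx => rw [map_smul, hx, smul_zero]
        have h1 := congrArg (fun q => stR q (nv (rho F rk gt w))) (stR_EE (F := F) hgt hn hc)
        simp only [stR_stR] at h1
        have h2 := key2 (F := F) hgt hn.2.1 hn.2.2 (htr _ _ _ hc.1 hg)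
        rw [← h1, EE, stR_add, stR_add, stR_X_pow_mul] at h2
        have h3 : DegLE (stR (E' F rk l u v (Rw F rk gt v u))
            (rho F rk gt v * nv (rho F rk gt w))) (l.2 + (rk v - rk w)) := by
          refine stR_degLE E'_deg fun i j hj => ?_
          exact hSS _ _ (E'_mem hgt hn hc (coeff_Rw_zero u)
            (fun j hj => Rw_mem hgt hn.2.1 j hj) i) j hj
        intro j hj
        have h4 := h2 (j + l.2) (by have := hc.2; have := hgt _ _ hg; omega)
        rw [map_add, map_add, h3 _ (by omega), ih _ (by omega), coeff_X_pow_mul] at h4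
        simpa using h4
      · have hnc : NC rk gt (l :: u) v := fun l' hl' => by simp at hl'; subst hl'; exact hc
        rw [← stR_stR, stR_rho_nrm hn, Rw_nc hnc]
        exact key2 hgt hn hnc hg
    · have h1 : stR (C (word F (l :: u))) (nv (rho F rk gt w)) = C (word F (l :: u)) := by
        conv_lhs => rw [← stR_rho_not (F := F) (w := w) hn]
        rw [stR_stR, mul_nv (rho_zero w), stR_one]
      rw [← stR_stR, stR_rho_not hn, h1]
      exact (degLE_C _).mono (Nat.zero_le _)

lemma key4 (hgt : ∀ v w, gt v w → rk w < rk v) (htr : ∀ u v w, gt u v → gt v w → gt u w)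
    {v w : V} (hg : gt v w) :
    DegLE (rho F rk gt v * nv (rho F rk gt w)) (rk v - rk w) := by
  intro j hj
  apply MulOpposite.unop_injective
  refine ext_word fun m => ?_
  have := key3 (F := F) hgt htr hg m j hj
  rw [coeff_stR_C] at this
  rw [this]; simp

lemma rho_bot {s : V} (hs : rk s = 0) : rho F rk gt s = 1 := by
  ext j
  rcases Nat.eq_zero_or_pos j with h | h
  · subst h; rw [rho_zero]; simp
  · apply MulOpposite.unop_injective
    refine ext_word fun m => ?_
    rw [coeff_rho, coeff_one, if_neg (by omega)]
    by_cases hm : Nrm rk gt m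
    · rw [Rop_nrm hm, Rw_deg _ _ (by omega)]; simp
    · rw [Rop_not hm, if_neg (by omega)]; simp

end ops
end DB

namespace DB
open PowerSeries GLG

section link
variable {F : Type} [Field F] {V E : Type} {tl hd : E → V} {rk : V → ℕ}

/-- Strict order of the graph. -/
def gtG (tl hd : E → V) : V → V → Prop :=
  Relation.TransGen (fun v w => ∃ e, tl e = v ∧ hd e = w)

lemma gtG_edge (e : E) : gtG tl hd (tl e) (hd e) := Relation.TransGen.single ⟨e, rfl, rfl⟩

lemma gtG_lt (hR : IsRank tl hd rk) (v w : V) (h : gtG tl hd v w) : rk w < rk v := by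
  induction h with
  | single h => obtain ⟨e, rfl, rfl⟩ := h; exact hR e
  | tail _ h ih => obtain ⟨e, rfl, rfl⟩ := h; exact (hR e).trans ih

lemma gtG_trans (u v w : V) (h : gtG tl hd u v) (h' : gtG tl hd v w) : gtG tl hd u w :=
  Relation.TransGen.trans h h'

lemma nsq {R : Type} [Ring R] (j : ℕ) : (-1 : R) ^ j * (-1) ^ j = 1 := by
  rw [← pow_add]; exact Even.neg_one_pow ⟨j, rfl⟩

lemma c0mul {R : Type} [Ring R] (f g : PowerSeries R) :
    coeff 0 (f * g) = coeff 0 f * coeff 0 g := by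
  rw [coeff_mul]; simp

/-- power series of the image of a polynomial. -/
noncomputable def ps {A B : Type} [Ring A] [Ring B] [Algebra F A] [Algebra F B] (f : A →ₐ[F] B)
    (p : Polynomial A) : PowerSeries B := PowerSeries.mk fun n => f (p.coeff n)

lemma ps_mul {A B : Type} [Ring A] [Ring B] [Algebra F A] [Algebra F B] (f : A →ₐ[F] B)
    (p q : Polynomial A) : ps f (p * q) = ps f p * ps f q := by
  ext n
  simp [ps, Polynomial.coeff_mul, PowerSeries.coeff_mul]

lemma ps_one {A B : Type} [Ring A] [Ring B] [Algebra F A] [Algebra F B] (f : A →ₐ[F] B) :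
    ps f (1 : Polynomial A) = 1 := by
  ext n
  simp only [ps, coeff_mk, Polynomial.coeff_one, PowerSeries.coeff_one]
  split_ifs <;> simp

lemma coeff_Pe (e : E) (j : ℕ) : (Pe F tl hd rk e).coeff j =
    if h : 1 ≤ j ∧ j ≤ len tl hd rk e then (-1) ^ j * FreeAlgebra.ι F ⟨e, ⟨j, h⟩⟩
    else if j = 0 then 1 else 0 := by
  rw [Pe, Polynomial.coeff_add, Polynomial.finsetSum_coeff, Polynomial.coeff_one]
  simp only [Polynomial.coeff_C_mul_X_pow]
  by_cases h : 1 ≤ j ∧ j ≤ len tl hd rk e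
  · rw [dif_pos h, if_neg (by omega), Finset.sum_eq_single ⟨j, Finset.mem_Icc.2 h⟩]
    · simp
    · intro b _ hb
      rw [if_neg]
      intro h'; exact hb (Subtype.ext h'.symm)
    · intro h'; simp at h'
  · rw [dif_neg h, Finset.sum_eq_zero, add_zero]
    intro b _
    rw [if_neg]
    intro h'; exact h (h' ▸ Finset.mem_Icc.1 b.2)

section
variable {B : Type} [Ring B] [Algebra F B] (f : FreeAlgebra F (ESharp tl hd rk) →ₐ[F] B)

lemma ps_Pe_zero (e : E) : coeff 0 (ps f (Pe F tl hd rk e)) = 1 := by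
  simp [ps, coeff_Pe]

lemma ps_Pe_deg (e : E) : DegLE (ps f (Pe F tl hd rk e)) (rk (tl e) - rk (hd e)) := by
  intro m hm
  rw [ps, coeff_mk, coeff_Pe, dif_neg, if_neg (by omega), map_zero]
  rw [len]; omega

noncomputable def pprod (es : List E) : PowerSeries B :=
  ps f ((es.map (Pe F tl hd rk)).prod)

lemma pprod_nil : pprod f [] = 1 := by simp [pprod, ps_one]
lemma pprod_cons (e : E) (es : List E) :
    pprod f (e :: es) = ps f (Pe F tl hd rk e) * pprod f es := by
  simp [pprod, ps_mul]

lemma isPath_cons {e e' : E} {es : List E} :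
    IsPathC tl hd e (e' :: es) ↔ hd e = tl e' ∧ IsPathC tl hd e' es := by
  show List.IsChain _ (e :: e' :: es) ↔ _ ∧ List.IsChain _ (e' :: es)
  simp

lemma isPath_nil (e : E) : IsPathC tl hd e [] := by
  show List.IsChain _ [e]
  simp

lemma pathDst_cons {e e' : E} {es : List E} : pathDst hd e (e' :: es) = pathDst hd e' es := by
  simp [pathDst]

lemma pathDst_nil {e : E} : pathDst hd e [] = hd e := by
  simp [pathDst]

lemma path_tel (P : V → PowerSeries B)
    (hP : ∀ e, ps f (Pe F tl hd rk e) * P (hd e) = P (tl e)) (e : E) (es : List E)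
    (h : IsPathC tl hd e es) : pprod f (e :: es) * P (pathDst hd e es) = P (tl e) := by
  induction es generalizing e with
  | nil => rw [pprod_cons, pprod_nil, mul_one, pathDst_nil, hP]
  | cons e' es ih =>
    obtain ⟨h1, h2⟩ := isPath_cons.1 h
    rw [pprod_cons, pathDst_cons, mul_assoc, ih e' h2, ← h1, hP]

lemma path_deg (hR : IsRank tl hd rk) (e : E) (es : List E) (h : IsPathC tl hd e es) :
    rk (pathDst hd e es) < rk (tl e) ∧
    DegLE (pprod f (e :: es)) (rk (tl e) - rk (pathDst hd e es)) := by
  induction es generalizing e with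
  | nil => rw [pprod_cons, pprod_nil, mul_one, pathDst_nil]; exact ⟨hR e, ps_Pe_deg f e⟩
  | cons e' es ih =>
    obtain ⟨h1, h2⟩ := isPath_cons.1 h
    obtain ⟨h3, h4⟩ := ih e' h2
    have := hR e
    rw [pprod_cons, pathDst_cons]
    refine ⟨by rw [h1] at this; omega, ((ps_Pe_deg f e).mul h4).mono ?_⟩
    rw [h1] at this ⊢; omega

lemma pprod_zero (es : List E) : coeff 0 (pprod f es) = 1 := by
  induction es with
  | nil => simp [pprod_nil]
  | cons e es ih =>
    rw [pprod_cons, c0mul]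
    have h1 := ps_Pe_zero f e
    rw [h1, ih, mul_one]

lemma map_eP (es : List E) (j : ℕ) : f (eP F tl hd rk es j) = (-1) ^ j * coeff j (pprod f es) := by
  simp [eP, pprod, ps]

end

lemma rel_path (hR : IsRank tl hd rk) {e1 e2 : E} {es1 es2 : List E}
    (h1 : IsPathC tl hd e1 es1) (h2 : IsPathC tl hd e2 es2) (ht : tl e1 = tl e2)
    (hh : pathDst hd e1 es1 = pathDst hd e2 es2) :
    pprod (mkA F tl hd rk) (e1 :: es1) = pprod (mkA F tl hd rk) (e2 :: es2) := by
  ext j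
  rcases Nat.eq_zero_or_pos j with h | h
  · subst h; rw [pprod_zero, pprod_zero]
  · by_cases hj : j ≤ rk (tl e1) - rk (pathDst hd e1 es1)
    · have hr : rel F tl hd rk (eP F tl hd rk (e1 :: es1) j) (eP F tl hd rk (e2 :: es2) j) :=
        ⟨e1, es1, e2, es2, j, h1, h2, ht, hh, h, hj, rfl, rfl⟩
      have h3 : mkA F tl hd rk _ = mkA F tl hd rk _ := RingQuot.mkAlgHom_rel F hr
      rw [map_eP, map_eP] at h3
      have h4 := congrArg (fun x => (-1) ^ j * x) h3
      simp only [← mul_assoc, nsq, one_mul] at h4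
      exact h4
    · rw [(path_deg _ hR _ _ h1).2 _ (by omega), (path_deg _ hR _ _ h2).2 _ (by
        rw [← ht, ← hh]; omega)]

noncomputable def theta0 (F : Type) [Field F] (tl hd : E → V) (rk : V → ℕ) :
    FreeAlgebra F (ESharp tl hd rk) →ₐ[F] (Module.End F (TT F V))ᵐᵒᵖ :=
  FreeAlgebra.lift F fun x => (-1) ^ x.2.1 *
    coeff x.2.1 (rho F rk (gtG tl hd) (tl x.1) * nv (rho F rk (gtG tl hd) (hd x.1)))

lemma theta0_Pe (hR : IsRank tl hd rk) (e : E) : ps (theta0 F tl hd rk) (Pe F tl hd rk e) =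
    rho F rk (gtG tl hd) (tl e) * nv (rho F rk (gtG tl hd) (hd e)) := by
  ext j
  rw [ps, coeff_mk, coeff_Pe]
  split_ifs with h h0
  · rw [map_mul, theta0, FreeAlgebra.lift_ι_apply, map_pow, map_neg, map_one, ← mul_assoc,
      nsq, one_mul]
  · subst h0
    rw [map_one, c0mul]
    have h1 := rho_zero (F := F) (rk := rk) (gt := gtG tl hd) (tl e)
    have h2 := congrArg (coeff 0) (mul_nv (rho_zero (F := F) (rk := rk) (gt := gtG tl hd) (hd e)))
    rw [c0mul, rho_zero, one_mul] at h2
    rw [h1, h2]; simp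
  · rw [map_zero, key4 (gtG_lt hR) gtG_trans (gtG_edge e)]
    rw [len] at h; omega

lemma theta0_tel (hR : IsRank tl hd rk) (e : E) :
    ps (theta0 F tl hd rk) (Pe F tl hd rk e) * rho F rk (gtG tl hd) (hd e) =
      rho F rk (gtG tl hd) (tl e) := by
  rw [theta0_Pe hR, mul_assoc, nv_mul (rho_zero _), mul_one]

lemma theta0_rel (hR : IsRank tl hd rk) ⦃x y : FreeAlgebra F (ESharp tl hd rk)⦄
    (h : rel F tl hd rk x y) : theta0 F tl hd rk x = theta0 F tl hd rk y := by
  obtain ⟨e1, es1, e2, es2, j, h1, h2, ht, hh, -, -, rfl, rfl⟩ := h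
  rw [map_eP, map_eP]
  have a1 := path_tel (theta0 F tl hd rk) _ (theta0_tel hR) e1 es1 h1
  have a2 := path_tel (theta0 F tl hd rk) _ (theta0_tel hR) e2 es2 h2
  rw [← ht, ← hh, ← a1] at a2
  have a3 := congrArg (fun q => q * nv (rho F rk (gtG tl hd) (pathDst hd e1 es1))) a2
  simp only [mul_assoc, mul_nv (rho_zero _), mul_one] at a3
  rw [a3]

noncomputable def theta (hR : IsRank tl hd rk) :
    AGamma F tl hd rk →ₐ[F] (Module.End F (TT F V))ᵐᵒᵖ :=
  RingQuot.liftAlgHom F ⟨theta0 F tl hd rk, theta0_rel hR⟩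

lemma theta_mkA (hR : IsRank tl hd rk) (x) : theta hR (mkA F tl hd rk x) = theta0 F tl hd rk x :=
  RingQuot.liftAlgHom_mkAlgHom_apply F _ _ x

end link
end DB

namespace DB
open PowerSeries GLG

section gen2
lemma map_nv {R S : Type} [Ring R] [Ring S] (f : R →+* S) {a : PowerSeries R}
    (h : coeff 0 a = 1) : PowerSeries.map f (nv a) = nv (PowerSeries.map f a) := by
  have h1 : PowerSeries.map f (nv a) * PowerSeries.map f a = 1 := by
    rw [← map_mul, nv_mul h, map_one]
  have h2 : PowerSeries.map f a * nv (PowerSeries.map f a) = 1 := by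
    apply mul_nv; rw [coeff_map, h, map_one]
  exact left_inv_eq_right_inv h1 h2

lemma map_tr {R S : Type} [Ring R] [Ring S] (f : R →+* S) (k : ℕ) (a : PowerSeries R) :
    PowerSeries.map f (tr k a) = tr k (PowerSeries.map f a) := by
  ext n
  simp only [tr, coeff_map, coeff_mk]
  split_ifs <;> simp

lemma X_pow_cancel {R : Type} [Ring R] {k : ℕ} {f g : PowerSeries R} (h : X ^ k * f = X ^ k * g) :
    f = g := by
  ext n
  have := congrArg (coeff (n + k)) h
  rwa [coeff_X_pow_mul, coeff_X_pow_mul] at this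

lemma ring_id1 {R : Type} [Ring R] (a q p i : R) :
    (a * (q * p) - a * p) * i = a * (q - 1) * (p * i) := by
  simp only [mul_sub, sub_mul, mul_one, mul_assoc]

lemma ring_id2 {R : Type} [Ring R] (a q p x : R) :
    a * (q * p) - a * p - (a * (q - 1) - x) * p = x * p := by
  simp only [mul_sub, sub_mul, mul_one, mul_assoc]
  abel
end gen2

section link
variable {F : Type} [Field F] {V E : Type} {tl hd : E → V} {rk : V → ℕ}

lemma exists_path (hR : IsRank tl hd rk) {s : V} (hmin : ∀ v, (∀ e, tl e ≠ v) → v = s)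
    (v : V) : v ≠ s → ∃ (e : E) (es : List E), IsPathC tl hd e es ∧ tl e = v ∧
      pathDst hd e es = s := by
  induction hn : rk v using Nat.strong_induction_on generalizing v with
  | _ n ih =>
    intro hv
    have : ∃ e, tl e = v := by
      by_contra! h
      exact hv (hmin v h)
    obtain ⟨e, rfl⟩ := this
    by_cases h : hd e = s
    · exact ⟨e, [], isPath_nil e, rfl, by rw [pathDst_nil, h]⟩
    · obtain ⟨e', es, h1, h2, h3⟩ := ih _ (hn ▸ hR e) (hd e) rfl h
      exact ⟨e, e' :: es, isPath_cons.2 ⟨h2.symm, h1⟩, rfl, by rw [pathDst_cons, h3]⟩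

open Classical in
noncomputable def pth (tl hd : E → V) (s v : V) : List E :=
  if h : v ≠ s ∧ ∃ (e : E) (es : List E), IsPathC tl hd e es ∧ tl e = v ∧ pathDst hd e es = s then
    h.2.choose :: h.2.choose_spec.choose else []

lemma pth_bot (s : V) : pth tl hd s s = [] := by simp [pth]

lemma pth_ne (hR : IsRank tl hd rk) {s : V} (hmin : ∀ v, (∀ e, tl e ≠ v) → v = s)
    {v : V} (hv : v ≠ s) : ∃ (e : E) (es : List E), pth tl hd s v = e :: es ∧
      IsPathC tl hd e es ∧ tl e = v ∧ pathDst hd e es = s := by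
  have h : v ≠ s ∧ ∃ (e : E) (es : List E), IsPathC tl hd e es ∧ tl e = v ∧
    pathDst hd e es = s := ⟨hv, exists_path hR hmin v hv⟩
  exact ⟨_, _, by rw [pth, dif_pos h], h.2.choose_spec.choose_spec⟩

noncomputable def PP (F : Type) [Field F] (tl hd : E → V) (rk : V → ℕ) (s v : V) :
    PowerSeries (AGamma F tl hd rk) := pprod (mkA F tl hd rk) (pth tl hd s v)

lemma PP_zero (s v : V) : coeff 0 (PP F tl hd rk s v) = 1 := pprod_zero _ _

section
variable (hR : IsRank tl hd rk) {s : V} (hmin : ∀ v, (∀ e, tl e ≠ v) ↔ v = s)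
include hR hmin

lemma PP_edge (e : E) : ps (mkA F tl hd rk) (Pe F tl hd rk e) * PP F tl hd rk s (hd e) =
    PP F tl hd rk s (tl e) := by
  have h0 : tl e ≠ s := fun h => (hmin s).2 rfl e h
  obtain ⟨e', es', h1, h2, h3, h4⟩ := pth_ne hR (fun v => (hmin v).1) h0
  by_cases h : hd e = s
  · rw [PP, PP, h, pth_bot, h1, pprod_nil, ← pprod_nil (mkA F tl hd rk), ← pprod_cons]
    exact rel_path hR (isPath_nil e) h2 h3.symm (by rw [pathDst_nil, h4, h])
  · obtain ⟨e2, es2, a1, a2, a3, a4⟩ := pth_ne hR (fun v => (hmin v).1) h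
    rw [PP, PP, h1, a1, ← pprod_cons]
    exact rel_path hR (isPath_cons.2 ⟨a3.symm, a2⟩) h2 h3.symm (by rw [pathDst_cons, h4, a4])

lemma PP_deg (hs : rk s = 0) (v : V) : DegLE (PP F tl hd rk s v) (rk v) := by
  by_cases h : v = s
  · subst h
    rw [PP, pth_bot, pprod_nil]
    have := degLE_C (1 : AGamma F tl hd rk)
    rw [map_one] at this
    exact this.mono (Nat.zero_le _)
  · obtain ⟨e', es', h1, h2, h3, h4⟩ := pth_ne hR (fun v => (hmin v).1) h
    rw [PP, h1]
    have := (path_deg (mkA F tl hd rk) hR _ _ h2).2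
    rwa [h3, h4, hs, Nat.sub_zero] at this

lemma PP_quot {v w : V} (h : gtG tl hd v w) : ∃ q, DegLE q (rk v - rk w) ∧
    q * PP F tl hd rk s w = PP F tl hd rk s v := by
  induction h with
  | single h => obtain ⟨e, rfl, rfl⟩ := h; exact ⟨_, ps_Pe_deg _ e, PP_edge hR hmin e⟩
  | tail h0 h ih =>
    obtain ⟨e, rfl, rfl⟩ := h
    obtain ⟨q, h1, h2⟩ := ih
    refine ⟨q * ps (mkA F tl hd rk) (Pe F tl hd rk e), (h1.mul (ps_Pe_deg _ e)).mono ?_, ?_⟩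
    · have := hR e
      have := gtG_lt hR _ _ h0
      omega
    · rw [mul_assoc, PP_edge hR hmin, h2]

lemma theta_PP (hs : rk s = 0) (v : V) (j : ℕ) :
    theta hR (coeff j (PP F tl hd rk s v)) = coeff j (rho F rk (gtG tl hd) v) := by
  have h1 : ∀ es, theta hR (coeff j (pprod (mkA F tl hd rk) es)) =
      coeff j (pprod (theta0 F tl hd rk) es) := by
    intro es
    simp only [pprod, ps, coeff_mk, theta_mkA]
  rw [PP, h1]
  congr 1
  by_cases h : v = s
  · subst h
    rw [pth_bot, pprod_nil, rho_bot hs]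
  · obtain ⟨e', es', a1, h2, h3, h4⟩ := pth_ne hR (fun v => (hmin v).1) h
    have a2 := path_tel (theta0 F tl hd rk) _ (theta0_tel hR) e' es' h2
    rw [h4, rho_bot hs, mul_one] at a2
    rw [a1, a2, h3]

end

noncomputable def phi (F : Type) [Field F] (tl hd : E → V) (rk : V → ℕ) (s : V) :
    TT F V →ₐ[F] AGamma F tl hd rk :=
  FreeAlgebra.lift F fun x => coeff x.2 (PP F tl hd rk s x.1)

noncomputable abbrev phiS (F : Type) [Field F] (tl hd : E → V) (rk : V → ℕ) (s : V) :
    PowerSeries (TT F V) →+* PowerSeries (AGamma F tl hd rk) :=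
  PowerSeries.map (phi F tl hd rk s : TT F V →+* AGamma F tl hd rk)

lemma phi_word_cons (s : V) (l : V × ℕ) (u : List (V × ℕ)) :
    phi F tl hd rk s (word F (l :: u)) =
      phi F tl hd rk s (word F u) * coeff l.2 (PP F tl hd rk s l.1) := by
  rw [word, map_mul, phi, FreeAlgebra.lift_ι_apply]

section
variable (hR : IsRank tl hd rk) {s : V} (hmin : ∀ v, (∀ e, tl e ≠ v) ↔ v = s) (hs : rk s = 0)
include hR hmin hs

lemma phiS_As (v : V) : phiS F tl hd rk s (As F rk v) = PP F tl hd rk s v := by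
  ext j
  rw [coeff_map, coeff_As, ltr]
  split_ifs with h h1
  · subst h; rw [PP_zero, map_one]
  · simp [phi]
  · rw [map_zero, PP_deg hR hmin hs v _ (by omega)]

lemma theta_phi {m : List (V × ℕ)} (hm : Nrm rk (gtG tl hd) m) :
    (theta hR (phi F tl hd rk s (word F m))).unop 1 = word F m := by
  induction m with
  | nil => simp [word]
  | cons l u ih =>
    rw [phi_word_cons, map_mul, theta_PP hR hmin hs, MulOpposite.unop_mul, Module.End.mul_apply,
      ih hm.2.1, coeff_rho, Rop_nrm hm.2.1, Rw_nc hm.2.2, coeff_C_mul, coeff_As, ltr,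
      if_neg (by have := hm.1.1; omega), if_pos hm.1.2]
    rfl

lemma phi_Rw {m : List (V × ℕ)} (hm : Nrm rk (gtG tl hd) m) (w : V) :
    phiS F tl hd rk s (Rw F rk (gtG tl hd) w m) =
      C (phi F tl hd rk s (word F m)) * PP F tl hd rk s w := by
  induction m with
  | nil => rw [Rw_nc (fun l hl => by simp at hl), map_mul, phiS_As hR hmin hs, map_C]; rfl
  | cons l u ih =>
    by_cases hc : cov rk (gtG tl hd) l w
    · obtain ⟨q, hq, hq2⟩ := PP_quot (F := F) hR hmin hc.1
      have hk : rk l.1 - rk w = l.2 := by have := hc.2; omega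
      rw [hk] at hq
      have h1 := congrArg (phiS F tl hd rk s) (Rw_cov (F := F) (u := u) hc)
      have hX : phiS F tl hd rk s X = X := map_X _
      have hC : ∀ x, phiS F tl hd rk s (C x) = C (phi F tl hd rk s x) := fun x => map_C _ _
      have hE : phiS F tl hd rk s (E' F rk l u w (Rw F rk (gtG tl hd) w u)) =
          C (phi F tl hd rk s (word F u)) * (q - 1) -
            X ^ l.2 * C (phi F tl hd rk s (word F (l :: u))) := by
        rw [E', map_sub, map_mul, map_pow, hX, hC, map_tr, map_mul, map_nv _ (coeff_As_zero w),
          map_sub, map_mul, hC, phiS_As hR hmin hs, phiS_As hR hmin hs, ih hm.2.1, ← hq2]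
        congr 1
        have : (C (phi F tl hd rk s (word F u)) * (q * PP F tl hd rk s w) -
            C (phi F tl hd rk s (word F u)) * PP F tl hd rk s w) * nv (PP F tl hd rk s w) =
            C (phi F tl hd rk s (word F u)) * (q - 1) * (PP F tl hd rk s w *
              nv (PP F tl hd rk s w)) := ring_id1 _ _ _ _
        rw [this, mul_nv (PP_zero _ _), mul_one]
        have h1 : DegLE (1 : PowerSeries (AGamma F tl hd rk)) l.2 := by
          have := degLE_C (1 : AGamma F tl hd rk)
          rw [map_one] at this
          exact this.mono (Nat.zero_le _)
        have h2 := (degLE_C (phi F tl hd rk s (word F u))).mul (hq.sub h1)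
        rw [zero_add] at h2
        exact h2.tr_eq
      rw [map_mul, map_pow, hX, map_sub, map_sub, map_mul, map_mul, hC, hE, ih hm.2.1,
        phiS_As hR hmin hs, phiS_As hR hmin hs, ← hq2] at h1
      apply X_pow_cancel (k := l.2)
      rw [h1, ring_id2, mul_assoc]
    · have hnc : NC rk (gtG tl hd) (l :: u) w := fun l' hl' => by simp at hl'; subst hl'; exact hc
      rw [Rw_nc hnc, map_mul, phiS_As hR hmin hs, map_C]; rfl

end

noncomputable def DD (F : Type) [Field F] (tl hd : E → V) (rk : V → ℕ) (s : V) (n : ℕ) :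
    Submodule F (AGamma F tl hd rk) :=
  Submodule.span F (Set.range fun m : {m : List (V × ℕ) // Nrm rk (gtG tl hd) m ∧ dg m = n} =>
    phi F tl hd rk s (word F m.1))

lemma phi_SS {s w : V} {n : ℕ} {x : TT F V} (hx : x ∈ SS F rk (gtG tl hd) w n) :
    phi F tl hd rk s x ∈ DD F tl hd rk s n := by
  induction hx using Submodule.span_induction with
  | mem x hx =>
    obtain ⟨m, hm, hnc, hd, rfl⟩ := hx
    exact Submodule.subset_span ⟨⟨m, hm, hd⟩, rfl⟩
  | zero => simp
  | add x y _ _ hx hy => rw [map_add]; exact Submodule.add_mem _ hx hy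
  | smul a x _ hx => rw [map_smul]; exact Submodule.smul_mem _ _ hx

section
variable (hR : IsRank tl hd rk) {s : V} (hmin : ∀ v, (∀ e, tl e ≠ v) ↔ v = s) (hs : rk s = 0)
include hR hmin hs

lemma DD_mul_PP {n j : ℕ} {x : AGamma F tl hd rk} (hx : x ∈ DD F tl hd rk s n) (v : V) :
    x * coeff j (PP F tl hd rk s v) ∈ DD F tl hd rk s (n + j) := by
  induction hx using Submodule.span_induction with
  | mem x hx =>
    obtain ⟨⟨m, hm, hd⟩, rfl⟩ := hx
    have h1 := congrArg (coeff j) (phi_Rw (F := F) hR hmin hs hm v)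
    rw [coeff_C_mul, coeff_map] at h1
    simp only
    rw [← h1]
    rcases Nat.eq_zero_or_pos j with h | h
    · subst h
      rw [coeff_Rw_zero]
      exact Submodule.subset_span ⟨⟨m, hm, hd⟩, rfl⟩
    · rw [← hd]
      exact phi_SS (Rw_mem (gtG_lt hR) hm j h)
  | zero => simp
  | add x y _ _ hx hy => rw [add_mul]; exact Submodule.add_mem _ hx hy
  | smul a x _ hx => rw [smul_mul_assoc]; exact Submodule.smul_mem _ _ hx

lemma DD_mul_gen {n : ℕ} {x : AGamma F tl hd rk} (hx : x ∈ DD F tl hd rk s n)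
    (a : ESharp tl hd rk) :
    x * mkA F tl hd rk (FreeAlgebra.ι F a) ∈ DD F tl hd rk s (n + a.2.1) := by
  obtain ⟨e, ⟨i, hi⟩⟩ := a
  have h1 := quot_mem_series (F := F) (P := fun i => DD F tl hd rk s (n + i))
    (f := C x * PP F tl hd rk s (tl e))
    (g := C x * ps (mkA F tl hd rk) (Pe F tl hd rk e)) (A := PP F tl hd rk s (hd e))
    (PP_zero _ _) (by rw [mul_assoc, PP_edge hR hmin])
    (fun i j x hx => by rw [← add_assoc]; exact DD_mul_PP hR hmin hs hx _)
    (fun i => by rw [coeff_C_mul]; exact DD_mul_PP hR hmin hs hx _) i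
  rw [coeff_C_mul, ps, coeff_mk, coeff_Pe, dif_pos hi] at h1
  simp only
  have h2 := Submodule.smul_mem _ ((-1 : F) ^ i) h1
  have h3 : ((-1 : F) ^ i) • (x * mkA F tl hd rk ((-1) ^ i * FreeAlgebra.ι F ⟨e, ⟨i, hi⟩⟩)) =
      x * mkA F tl hd rk (FreeAlgebra.ι F ⟨e, ⟨i, hi⟩⟩) := by
    have : ((-1) ^ i * FreeAlgebra.ι F (⟨e, ⟨i, hi⟩⟩ : ESharp tl hd rk)) =
      ((-1 : F) ^ i) • FreeAlgebra.ι F (⟨e, ⟨i, hi⟩⟩ : ESharp tl hd rk) := by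
      rw [Algebra.smul_def, map_pow, map_neg, map_one]
    rw [this, map_smul, mul_smul_comm, smul_smul, nsq, one_smul]
  rwa [h3] at h2

lemma gpiece_le (n : ℕ) : gpiece F tl hd rk n ≤ DD F tl hd rk s n := by
  refine Submodule.span_le.2 ?_
  rintro x ⟨w, hw, rfl⟩
  induction w using List.reverseRecOn generalizing n with
  | nil =>
    simp at hw
    subst hw
    exact Submodule.subset_span ⟨⟨[], trivial, rfl⟩, by simp [word]⟩
  | append_singleton w a ih =>
    rw [List.map_append, List.sum_append] at hw
    rw [List.map_append, List.prod_append, map_mul]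
    simp only [List.map_cons, List.map_nil, List.sum_cons, List.sum_nil, List.prod_cons,
      List.prod_nil, mul_one, add_zero] at hw ⊢
    rw [← hw]
    exact DD_mul_gen hR hmin hs (ih _ rfl) a

omit hR hmin hs in
lemma gpiece_mul {a b : ℕ} {x y : AGamma F tl hd rk} (hx : x ∈ gpiece F tl hd rk a)
    (hy : y ∈ gpiece F tl hd rk b) : x * y ∈ gpiece F tl hd rk (a + b) := by
  have h := Submodule.mul_mem_mul hx hy
  rw [gpiece, gpiece, Submodule.span_mul_span] at h
  refine Submodule.span_mono ?_ h
  rintro z ⟨x, ⟨w, hw, rfl⟩, y, ⟨w', hw', rfl⟩, rfl⟩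
  exact ⟨w ++ w', by simp [hw, hw'], by simp⟩

omit hR hmin hs in
lemma gpiece_one : (1 : AGamma F tl hd rk) ∈ gpiece F tl hd rk 0 :=
  Submodule.subset_span ⟨[], by simp, by simp⟩

omit hR hmin hs in
lemma gpiece_pprod (es : List E) (j : ℕ) :
    coeff j (pprod (mkA F tl hd rk) es) ∈ gpiece F tl hd rk j := by
  induction es generalizing j with
  | nil =>
    rw [pprod_nil, coeff_one]
    split_ifs with h
    · subst h; exact gpiece_one
    · exact Submodule.zero_mem _
  | cons e es ih =>
    rw [pprod_cons]
    refine mul_mem_series (P := fun i => gpiece F tl hd rk i)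
      (fun i j x hx => gpiece_mul hx (ih j)) ?_ j
    intro i
    rw [ps, coeff_mk, coeff_Pe]
    split_ifs with h h0
    · have : ((-1) ^ i * FreeAlgebra.ι F (⟨e, ⟨i, h⟩⟩ : ESharp tl hd rk)) =
        ((-1 : F) ^ i) • FreeAlgebra.ι F (⟨e, ⟨i, h⟩⟩ : ESharp tl hd rk) := by
        rw [Algebra.smul_def, map_pow, map_neg, map_one]
      rw [this, map_smul]
      exact Submodule.smul_mem _ _ (Submodule.subset_span ⟨[⟨e, ⟨i, h⟩⟩], by simp, by simp⟩)
    · subst h0; rw [map_one]; exact gpiece_one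
    · rw [map_zero]; exact Submodule.zero_mem _

omit hR hmin hs in
lemma DD_le (n : ℕ) : DD F tl hd rk s n ≤ gpiece F tl hd rk n := by
  refine Submodule.span_le.2 ?_
  rintro x ⟨⟨m, hm, hd'⟩, rfl⟩
  simp only
  clear hm
  induction m generalizing n with
  | nil =>
    simp [dg] at hd'
    subst hd'
    simpa [word] using gpiece_one
  | cons l u ih =>
    rw [phi_word_cons]
    have : dg u + l.2 = n := by simp [dg] at hd' ⊢; omega
    rw [← this]
    exact gpiece_mul (ih _ rfl) (gpiece_pprod _ _)

lemma finrank_gpiece (n : ℕ) : Module.finrank F (gpiece F tl hd rk n) =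
    Nat.card {m : List (V × ℕ) // Nrm rk (gtG tl hd) m ∧ dg m = n} := by
  have h1 : gpiece F tl hd rk n = DD F tl hd rk s n :=
    le_antisymm (gpiece_le hR hmin hs n) (DD_le n)
  rw [h1]
  have hli : LinearIndependent F
      (fun m : {m : List (V × ℕ) // Nrm rk (gtG tl hd) m ∧ dg m = n} =>
        phi F tl hd rk s (word F m.1)) := by
    let ev : AGamma F tl hd rk →ₗ[F] TT F V :=
      (LinearMap.applyₗ (1 : TT F V)) ∘ₗ
        (MulOpposite.opLinearEquiv F).symm.toLinearMap ∘ₗ (theta hR).toLinearMap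
    apply LinearIndependent.of_comp ev
    have h2 : (ev ∘ fun m : {m : List (V × ℕ) // Nrm rk (gtG tl hd) m ∧ dg m = n} =>
        phi F tl hd rk s (word F m.1)) = fun m => bas F m.1 := by
      funext m
      rw [bas_apply]
      exact theta_phi hR hmin hs m.2.1
    rw [h2]
    exact (bas F).linearIndependent.comp _ Subtype.val_injective
  exact Module.finrank_eq_nat_card_basis (Module.Basis.span hli)

end
end link
end DB

namespace DB
open PowerSeries GLG

section cnt
variable {V : Type}

def piece (A : Set (List (V × ℕ))) (n : ℕ) : Set (List (V × ℕ)) := {m | m ∈ A ∧ dg m = n}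

def Fn (A : Set (List (V × ℕ))) : Prop := ∀ n, (piece A n).Finite

noncomputable def cnt (A : Set (List (V × ℕ))) : PowerSeries ℤ :=
  PowerSeries.mk fun n => ((piece A n).ncard : ℤ)

lemma Fn.mono {A B : Set (List (V × ℕ))} (hB : Fn B) (h : A ⊆ B) : Fn A :=
  fun n => (hB n).subset fun _ hm => ⟨h hm.1, hm.2⟩

lemma Fn.union {A B : Set (List (V × ℕ))} (hA : Fn A) (hB : Fn B) : Fn (A ∪ B) := fun n =>
  ((hA n).union (hB n)).subset fun _ hm => hm.1.elim (fun h => Or.inl ⟨h, hm.2⟩)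
    (fun h => Or.inr ⟨h, hm.2⟩)

lemma dg_cons (l : V × ℕ) (u : List (V × ℕ)) : dg (l :: u) = l.2 + dg u := by simp [dg]

lemma piece_cons (l : V × ℕ) (A : Set (List (V × ℕ))) (n : ℕ) :
    piece (List.cons l '' A) n = if l.2 ≤ n then List.cons l '' (piece A (n - l.2)) else ∅ := by
  split_ifs with h
  · ext m; constructor
    · rintro ⟨⟨u, hu, rfl⟩, h2⟩
      rw [dg_cons] at h2
      exact ⟨u, ⟨hu, by omega⟩, rfl⟩
    · rintro ⟨u, ⟨hu, h2⟩, rfl⟩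
      exact ⟨⟨u, hu, rfl⟩, by rw [dg_cons]; omega⟩
  · ext m; constructor
    · rintro ⟨⟨u, hu, rfl⟩, h2⟩
      rw [dg_cons] at h2; omega
    · intro h; exact h.elim

lemma Fn.cons {A : Set (List (V × ℕ))} (hA : Fn A) (l : V × ℕ) : Fn (List.cons l '' A) := by
  intro n
  rw [piece_cons]
  split_ifs
  · exact (hA _).image _
  · exact Set.finite_empty

lemma cnt_cons (l : V × ℕ) (A : Set (List (V × ℕ))) :
    cnt (List.cons l '' A) = X ^ l.2 * cnt A := by
  ext n
  rw [coeff_X_pow_mul', cnt, coeff_mk, piece_cons]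
  split_ifs with h
  · rw [Set.ncard_image_of_injective _ (List.cons_injective)]; simp [cnt]
  · simp

lemma cnt_union {A B : Set (List (V × ℕ))} (hA : Fn A) (hB : Fn B) (h : Disjoint A B) :
    cnt (A ∪ B) = cnt A + cnt B := by
  ext n
  simp only [cnt, coeff_mk, map_add]
  have : piece (A ∪ B) n = piece A n ∪ piece B n := by
    ext m; simp only [piece, Set.mem_setOf_eq, Set.mem_union]; tauto
  rw [this, Set.ncard_union_eq _ (hA n) (hB n)]
  · push_cast; rfl
  · exact h.mono (fun _ hm => hm.1) (fun _ hm => hm.1)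

open Classical in
lemma cnt_bUnion (L : Finset (V × ℕ)) (A : V × ℕ → Set (List (V × ℕ))) (hA : ∀ l, Fn (A l)) :
    Fn (⋃ l ∈ L, List.cons l '' A l) ∧
    cnt (⋃ l ∈ L, List.cons l '' A l) = ∑ l ∈ L, X ^ l.2 * cnt (A l) := by
  induction L using Finset.induction_on with
  | empty =>
    simp only [Finset.notMem_empty, Set.iUnion_of_empty, Set.iUnion_empty, Finset.sum_empty]
    refine ⟨fun n => by simp [piece], ?_⟩
    ext n; simp [cnt, piece]
  | insert l L hl ih =>
    rw [Finset.set_biUnion_insert, Finset.sum_insert hl]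
    refine ⟨((hA l).cons l).union ih.1, ?_⟩
    rw [cnt_union ((hA l).cons l) ih.1, cnt_cons, ih.2]
    rw [Set.disjoint_left]
    rintro m ⟨u, hu, rfl⟩ h
    simp only [Set.mem_iUnion] at h
    obtain ⟨l', hl', u', _, h⟩ := h
    exact hl ((List.cons.inj h).1 ▸ hl')

variable [Fintype V] (rk : V → ℕ) (gt : V → V → Prop)

def SA : Set (List (V × ℕ)) := {m | Nrm rk gt m}
def SW (w : V) : Set (List (V × ℕ)) := {m | Nrm rk gt m ∧ NC rk gt m w}

lemma Fn_SA : Fn (SA rk gt) := by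
  intro n
  induction n using Nat.strong_induction_on with
  | _ n ih =>
    have h : piece (SA rk gt) n ⊆ {[]} ∪ ⋃ l ∈ (Set.univ : Set V) ×ˢ (Set.Icc 1 n),
        List.cons l '' (piece (SA rk gt) (n - l.2)) := by
      rintro m ⟨hm, hd⟩
      cases m with
      | nil => left; rfl
      | cons l u =>
        right
        rw [dg_cons] at hd
        have := hm.1.1
        simp only [Set.mem_iUnion]
        exact ⟨l, ⟨trivial, by simp; omega⟩, u, ⟨hm.2.1, by omega⟩, rfl⟩
    refine Set.Finite.subset (Set.Finite.union (Set.finite_singleton _) ?_) h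
    refine Set.Finite.biUnion (Set.finite_univ.prod (Set.finite_Icc 1 n)) ?_
    rintro l ⟨-, h1, h2⟩
    exact (ih _ (by omega)).image _

lemma Fn_SW (w : V) : Fn (SW rk gt w) := (Fn_SA rk gt).mono fun _ h => h.1

lemma SA_eq : cnt (SA rk gt) = 1 + ∑ v, (∑ k ∈ Finset.Icc 1 (rk v), X ^ k) * cnt (SW rk gt v) := by
  classical
  set L : Finset (V × ℕ) := Finset.univ.biUnion
    fun v => (Finset.Icc 1 (rk v)).image fun k => (v, k) with hL
  have hmem : ∀ l, l ∈ L ↔ 1 ≤ l.2 ∧ l.2 ≤ rk l.1 := by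
    rintro ⟨v, k⟩
    simp [hL]
  have h1 : SA rk gt = {[]} ∪ ⋃ l ∈ L, List.cons l '' SW rk gt l.1 := by
    ext m
    cases m with
    | nil => simp [SA, Nrm]
    | cons l u =>
      simp only [SA, Set.mem_setOf_eq, Nrm, Set.mem_union, Set.mem_singleton_iff, Set.mem_iUnion,
        reduceCtorEq, false_or]
      constructor
      · rintro ⟨a, b, c⟩
        exact ⟨l, (hmem l).2 a, u, ⟨b, c⟩, rfl⟩
      · rintro ⟨l', hl', u', ⟨b, c⟩, h⟩
        obtain ⟨rfl, rfl⟩ := List.cons.inj h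
        exact ⟨(hmem _).1 hl', b, c⟩
  obtain ⟨h2, h3⟩ := cnt_bUnion L (fun l => SW rk gt l.1) (fun l => Fn_SW rk gt l.1)
  have h4 : Fn ({[]} : Set (List (V × ℕ))) := fun n =>
    (Set.finite_singleton []).subset fun m hm => hm.1
  rw [h1, cnt_union h4 h2, h3]
  · congr 1
    · ext n
      rw [cnt, coeff_mk, coeff_one]
      have : piece ({[]} : Set (List (V × ℕ))) n = if n = 0 then {[]} else ∅ := by
        ext m
        simp only [piece, Set.mem_setOf_eq, Set.mem_singleton_iff]
        constructor
        · rintro ⟨rfl, rfl⟩; simp [dg]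
        · split_ifs with h
          · rintro rfl; exact ⟨rfl, by simp [dg, h]⟩
          · intro h; exact h.elim
      rw [this]; split_ifs <;> simp
    · rw [hL, Finset.sum_biUnion]
      · refine Finset.sum_congr rfl fun v _ => ?_
        rw [Finset.sum_image (fun a _ b _ h => (Prod.mk.inj h).2), Finset.sum_mul]
      · intro v _ w _ hvw
        rw [Function.onFun, Finset.disjoint_left]
        intro l h h'
        obtain ⟨a, -, rfl⟩ := Finset.mem_image.1 h
        obtain ⟨b, -, h⟩ := Finset.mem_image.1 h'
        exact hvw (Prod.mk.inj h).1.symm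
  · rw [Set.disjoint_left]
    rintro m rfl h
    simp at h

open Classical in
lemma SW_eq (hgt : ∀ v w, gt v w → rk w < rk v) (w : V) : cnt (SA rk gt) = cnt (SW rk gt w) +
    ∑ v ∈ Finset.univ.filter (fun v => gt v w), X ^ (rk v - rk w) * cnt (SW rk gt v) := by
  set L : Finset (V × ℕ) := (Finset.univ.filter (fun v => gt v w)).image
    fun v => (v, rk v - rk w) with hL
  have hmem : ∀ l, l ∈ L ↔ cov rk gt l w := by
    rintro ⟨v, k⟩
    simp only [hL, Finset.mem_image, Finset.mem_filter, Finset.mem_univ, true_and, cov,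
      Prod.mk.injEq]
    constructor
    · rintro ⟨v, h, rfl, rfl⟩
      have := hgt _ _ h
      exact ⟨h, by omega⟩
    · rintro ⟨h, h1⟩
      exact ⟨v, h, rfl, by omega⟩
  have h1 : SA rk gt = SW rk gt w ∪ ⋃ l ∈ L, List.cons l '' SW rk gt l.1 := by
    ext m
    constructor
    · intro hm
      by_cases hnc : NC rk gt m w
      · exact Or.inl ⟨hm, hnc⟩
      · right
        simp only [NC, not_forall, not_not] at hnc
        obtain ⟨l, hl, hc⟩ := hnc
        cases m with
        | nil => simp at hl
        | cons l' u =>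
          simp at hl; subst hl
          simp only [Set.mem_iUnion]
          exact ⟨l', (hmem _).2 hc, u, ⟨hm.2.1, hm.2.2⟩, rfl⟩
    · rintro (h | h)
      · exact h.1
      · simp only [Set.mem_iUnion] at h
        obtain ⟨l, hl, u, ⟨b, c⟩, rfl⟩ := h
        have hc := (hmem _).1 hl
        have := hgt _ _ hc.1
        have := hc.2
        exact ⟨⟨by omega, by omega⟩, b, c⟩
  obtain ⟨h2, h3⟩ := cnt_bUnion L (fun l => SW rk gt l.1) (fun l => Fn_SW rk gt l.1)
  rw [h1, cnt_union (Fn_SW rk gt w) h2, h3]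
  · congr 1
    rw [hL, Finset.sum_image (fun a _ b _ h => (Prod.mk.inj h).1)]
  · rw [Set.disjoint_left]
    rintro m hm h
    simp only [Set.mem_iUnion] at h
    obtain ⟨l, hl, u, _, rfl⟩ := h
    exact hm.2 l (by simp) ((hmem _).1 hl)

end cnt

open Classical in
theorem key5 (F : Type) [Field F] {V E : Type} [Fintype V] {tl hd : E → V} {rk : V → ℕ}
    (hR : IsRank tl hd rk) {s : V} (hmin : ∀ v, (∀ e, tl e ≠ v) ↔ v = s) (hs : rk s = 0) :
    ∃ g : V → PowerSeries ℤ,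
      (∀ w, g w = 1 - ∑ v ∈ Finset.univ.filter (fun v => gtG tl hd v w),
        X ^ (rk v - rk w) * g v) ∧
      Ring.inverse (hilb F tl hd rk) =
        1 - ∑ w, (∑ j ∈ Finset.Icc 1 (rk w), X ^ j) * g w := by
  set H := cnt (SA rk (gtG tl hd)) with hH
  have h1 : hilb F tl hd rk = H := by
    ext n
    rw [hilb, coeff_mk, finrank_gpiece hR hmin hs, hH, cnt, coeff_mk]
    rfl
  have h2 := SA_eq rk (gtG tl hd)
  rw [← hH] at h2
  have h0 : constantCoeff H = 1 := by
    rw [h2, map_add, map_sum, map_one, Finset.sum_eq_zero, add_zero]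
    intro v _
    rw [map_mul, map_sum, Finset.sum_eq_zero, zero_mul]
    intro k hk
    have := (Finset.mem_Icc.1 hk).1
    rw [map_pow, constantCoeff_X, zero_pow (by omega)]
  have h3 : H * invOfUnit H 1 = 1 := mul_invOfUnit H 1 (by simpa using h0)
  set H' := invOfUnit H 1
  have h4 : Ring.inverse H = H' := by
    let u : (PowerSeries ℤ)ˣ := ⟨H, H', h3, by rw [mul_comm]; exact h3⟩
    exact Ring.inverse_unit u
  refine ⟨fun w => cnt (SW rk (gtG tl hd) w) * H', ?_, ?_⟩
  · intro w
    have h5 := SW_eq rk (gtG tl hd) (gtG_lt hR) w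
    rw [← hH] at h5
    simp only [← mul_assoc, ← Finset.sum_mul]
    rw [eq_sub_iff_add_eq, ← add_mul, ← h5, h3]
  · rw [h1, h4]
    simp only [← mul_assoc, ← Finset.sum_mul]
    rw [eq_sub_iff_add_eq]
    conv_lhs => enter [1]; rw [← one_mul H']
    rw [← add_mul, ← h2, h3]

end DB

namespace DB
open PowerSeries GLG

section emb
variable {V E W E' : Type} {tl hd : E → V} {rk : V → ℕ} {T Hd : E' → W} {rk' : W → ℕ}
  {ε : V → W} {s : V}

lemma gt_emb (ha : ∀ e, ∃ e', T e' = ε (tl e) ∧ Hd e' = ε (hd e)) {v w : V}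
    (h : gtG tl hd v w) : gtG T Hd (ε v) (ε w) := by
  induction h with
  | single h =>
    obtain ⟨e, rfl, rfl⟩ := h
    exact Relation.TransGen.single (ha e)
  | tail _ h ih =>
    obtain ⟨e, rfl, rfl⟩ := h
    exact Relation.TransGen.tail ih (ha e)

lemma gt_emb' (hb : ∀ e' w, w ≠ s → Hd e' = ε w → ∃ e, T e' = ε (tl e) ∧ hd e = w)
    (hc : ∀ e, tl e ≠ s) {x y : W} (h : gtG T Hd x y) (w : V) (hw : w ≠ s) (hy : y = ε w) :
    ∃ v, x = ε v ∧ v ≠ s ∧ gtG tl hd v w := by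
  induction h generalizing w with
  | single h =>
    obtain ⟨e', rfl, rfl⟩ := h
    obtain ⟨e, h1, rfl⟩ := hb e' w hw hy
    exact ⟨tl e, h1, hc e, gtG_edge e⟩
  | tail _ h ih =>
    obtain ⟨e', rfl, rfl⟩ := h
    obtain ⟨e, h1, rfl⟩ := hb e' w hw hy
    obtain ⟨v, h2, h3, h4⟩ := ih (tl e) (hc e) h1
    exact ⟨v, h2, h3, gtG_trans _ _ _ h4 (gtG_edge e)⟩

open Classical in
lemma g_emb [Fintype V] [Fintype W] (hR : IsRank tl hd rk) (hinj : Function.Injective ε)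
    (hrk : ∀ v, rk' (ε v) = rk v)
    (ha : ∀ e, ∃ e', T e' = ε (tl e) ∧ Hd e' = ε (hd e))
    (hb : ∀ e' w, w ≠ s → Hd e' = ε w → ∃ e, T e' = ε (tl e) ∧ hd e = w)
    (hc : ∀ e, tl e ≠ s) (g : V → PowerSeries ℤ) (g' : W → PowerSeries ℤ)
    (hg : ∀ w, g w = 1 - ∑ v ∈ Finset.univ.filter (fun v => gtG tl hd v w),
        X ^ (rk v - rk w) * g v)
    (hg' : ∀ w, g' w = 1 - ∑ v ∈ Finset.univ.filter (fun v => gtG T Hd v w),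
        X ^ (rk' v - rk' w) * g' v) (w : V) (hw : w ≠ s) : g' (ε w) = g w := by
  have hM : ∀ v, rk v ≤ ∑ v, rk v := fun v =>
    Finset.single_le_sum (f := rk) (fun _ _ => Nat.zero_le _) (Finset.mem_univ v)
  induction hn : (∑ v, rk v) - rk w using Nat.strong_induction_on generalizing w with
  | _ n ih =>
    rw [hg, hg']
    congr 1
    have h1 : Finset.univ.filter (fun x => gtG T Hd x (ε w)) =
        (Finset.univ.filter (fun v => gtG tl hd v w)).image ε := by
      ext x
      simp only [Finset.mem_filter, Finset.mem_univ, true_and, Finset.mem_image]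
      constructor
      · intro h
        obtain ⟨v, h2, -, h4⟩ := gt_emb' hb hc h w hw rfl
        exact ⟨v, h4, h2.symm⟩
      · rintro ⟨v, h, rfl⟩
        exact gt_emb ha h
    rw [h1, Finset.sum_image (fun a _ b _ h => hinj h)]
    refine Finset.sum_congr rfl fun v hv => ?_
    have hv : gtG tl hd v w := (Finset.mem_filter.1 hv).2
    have h5 := gtG_lt hR _ _ hv
    have h6 := hM v
    obtain ⟨v', h2, h3, -⟩ := gt_emb' hb hc (gt_emb ha hv) w hw rfl
    obtain rfl := hinj h2
    rw [hrk, hrk, ih _ (by omega) v h3 rfl]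

end emb

open Classical in
lemma g_top {V E : Type} [Fintype V] {tl hd : E → V} {rk : V → ℕ} {t : V}
    (ht : ∀ e, hd e ≠ t) (g : V → PowerSeries ℤ)
    (hg : ∀ w, g w = 1 - ∑ v ∈ Finset.univ.filter (fun v => gtG tl hd v w),
        X ^ (rk v - rk w) * g v) : g t = 1 := by
  rw [hg, Finset.sum_eq_zero, sub_zero]
  intro v hv
  have hv : gtG tl hd v t := (Finset.mem_filter.1 hv).2
  obtain ⟨b, -, e, -, h⟩ := Relation.TransGen.tail'_iff.1 hv
  exact absurd h (ht e)

open Classical in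
lemma split_sum {V : Type} [Fintype V] {s t : V} (h : s ≠ t) (f : V → PowerSeries ℤ) :
    ∑ v, f v = (∑ v : {v : V // v ≠ s ∧ v ≠ t}, f v.1) + f s + f t := by
  have h1 : (Finset.univ : Finset V) =
      insert s (insert t (Finset.univ.filter (fun v => v ≠ s ∧ v ≠ t))) := by
    ext v
    simp only [Finset.mem_univ, Finset.mem_insert, Finset.mem_filter, true_and, true_iff]
    tauto
  have h2 : ∑ v : {v : V // v ≠ s ∧ v ≠ t}, f v.1 =
      ∑ v ∈ Finset.univ.filter (fun v => v ≠ s ∧ v ≠ t), f v :=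
    (Finset.sum_subtype _ (by simp) f).symm
  rw [h2, h1, Finset.sum_insert (by simp [h]), Finset.sum_insert (by simp), ← h1]
  ring

section db
variable {V1 E1 V2 E2 : Type} {s1 t1 : V1} {s2 t2 : V2}

lemma emb1_s : dbEmb1 s1 t1 s2 t2 s1 = Sum.inr false := by simp [dbEmb1]
lemma emb1_t (h : s1 ≠ t1) : dbEmb1 s1 t1 s2 t2 t1 = Sum.inr true := by
  simp [dbEmb1, h.symm]
lemma emb1_i (v : {v : V1 // v ≠ s1 ∧ v ≠ t1}) :
    dbEmb1 s1 t1 s2 t2 v.1 = Sum.inl (Sum.inl v) := by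
  simp [dbEmb1, v.2.1, v.2.2]
lemma emb2_s : dbEmb2 s1 t1 s2 t2 s2 = Sum.inr false := by simp [dbEmb2]
lemma emb2_t (h : s2 ≠ t2) : dbEmb2 s1 t1 s2 t2 t2 = Sum.inr true := by
  simp [dbEmb2, h.symm]
lemma emb2_i (v : {v : V2 // v ≠ s2 ∧ v ≠ t2}) :
    dbEmb2 s1 t1 s2 t2 v.1 = Sum.inl (Sum.inr v) := by
  simp [dbEmb2, v.2.1, v.2.2]

lemma cases3 {V : Type} (s t v : V) : v = s ∨ v = t ∨ ∃ u : {v : V // v ≠ s ∧ v ≠ t}, u.1 = v := by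
  by_cases h : v = s
  · exact Or.inl h
  · by_cases h' : v = t
    · exact Or.inr (Or.inl h')
    · exact Or.inr (Or.inr ⟨⟨v, h, h'⟩, rfl⟩)

lemma emb1_inj (h : s1 ≠ t1) : Function.Injective (dbEmb1 s1 t1 s2 t2) := by
  intro a b hab
  rcases cases3 s1 t1 a with ha | ha | ⟨a, rfl⟩ <;>
  rcases cases3 s1 t1 b with hb | hb | ⟨b, rfl⟩
  all_goals simp_all [emb1_s, emb1_t, emb1_i]

lemma emb2_inj (h : s2 ≠ t2) : Function.Injective (dbEmb2 s1 t1 s2 t2) := by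
  intro a b hab
  rcases cases3 s2 t2 a with ha | ha | ⟨a, rfl⟩ <;>
  rcases cases3 s2 t2 b with hb | hb | ⟨b, rfl⟩
  all_goals simp_all [emb2_s, emb2_t, emb2_i]

lemma emb_cross (h1 : s1 ≠ t1) (h2 : s2 ≠ t2) {a : V1} {b : V2}
    (h : dbEmb1 s1 t1 s2 t2 a = dbEmb2 s1 t1 s2 t2 b) :
    (a = s1 ∧ b = s2) ∨ (a = t1 ∧ b = t2) := by
  rcases cases3 s1 t1 a with rfl | rfl | ⟨a, rfl⟩ <;> rcases cases3 s2 t2 b with rfl | rfl | ⟨b, rfl⟩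
  all_goals simp_all [emb1_s, emb1_t, emb1_i, emb2_s, emb2_t, emb2_i]

variable {rk1 : V1 → ℕ} {rk2 : V2 → ℕ} {d : ℕ}

lemma rk_emb1 (h : s1 ≠ t1) (hs : rk1 s1 = 0) (ht : rk1 t1 = d) (v : V1) :
    dbRk rk1 rk2 s1 t1 s2 t2 d (dbEmb1 s1 t1 s2 t2 v) = rk1 v := by
  rcases cases3 s1 t1 v with rfl | rfl | ⟨v, rfl⟩
  · rw [emb1_s, hs]; simp [dbRk]
  · rw [emb1_t h, ht]; simp [dbRk]
  · rw [emb1_i]; simp [dbRk]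

lemma rk_emb2 (h : s2 ≠ t2) (hs : rk2 s2 = 0) (ht : rk2 t2 = d) (v : V2) :
    dbRk rk1 rk2 s1 t1 s2 t2 d (dbEmb2 s1 t1 s2 t2 v) = rk2 v := by
  rcases cases3 s2 t2 v with rfl | rfl | ⟨v, rfl⟩
  · rw [emb2_s, hs]; simp [dbRk]
  · rw [emb2_t h, ht]; simp [dbRk]
  · rw [emb2_i]; simp [dbRk]

end db

theorem main (F : Type) [Field F] {V1 E1 V2 E2 : Type}
    [Fintype V1] [Fintype V2]
    (tl1 hd1 : E1 → V1) (rk1 : V1 → ℕ) (hrank1 : GLG.IsRank tl1 hd1 rk1)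
    (tl2 hd2 : E2 → V2) (rk2 : V2 → ℕ) (hrank2 : GLG.IsRank tl2 hd2 rk2)
    (d : ℕ) (hd1d : 1 ≤ d)
    (s1 : V1) (hs1 : rk1 s1 = 0) (hmin1 : ∀ v : V1, (∀ e : E1, tl1 e ≠ v) ↔ v = s1)
    (s2 : V2) (hs2 : rk2 s2 = 0) (hmin2 : ∀ v : V2, (∀ e : E2, tl2 e ≠ v) ↔ v = s2)
    (t1 : V1) (ht1 : rk1 t1 = d) (hmax1 : ∀ v : V1, (∀ e : E1, hd1 e ≠ v) ↔ v = t1)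
    (t2 : V2) (ht2 : rk2 t2 = d) (hmax2 : ∀ v : V2, (∀ e : E2, hd2 e ≠ v) ↔ v = t2) :
    Ring.inverse (GLG.hilb F (GLG.dbTl tl1 tl2 s1 t1 s2 t2) (GLG.dbHd hd1 hd2 s1 t1 s2 t2)
          (GLG.dbRk rk1 rk2 s1 t1 s2 t2 d)) =
        Ring.inverse (GLG.hilb F tl1 hd1 rk1) + Ring.inverse (GLG.hilb F tl2 hd2 rk2) -
          (1 - ∑ j ∈ Finset.Icc 1 d, (PowerSeries.X : PowerSeries ℤ) ^ j) := by
  classical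
  have n1 : s1 ≠ t1 := by rintro rfl; omega
  have n2 : s2 ≠ t2 := by rintro rfl; omega
  have c1 : ∀ e, tl1 e ≠ s1 := (hmin1 s1).2 rfl
  have c2 : ∀ e, tl2 e ≠ s2 := (hmin2 s2).2 rfl
  have m1 : ∀ e, hd1 e ≠ t1 := (hmax1 t1).2 rfl
  have m2 : ∀ e, hd2 e ≠ t2 := (hmax2 t2).2 rfl
  have hR : IsRank (dbTl tl1 tl2 s1 t1 s2 t2) (dbHd hd1 hd2 s1 t1 s2 t2)
      (dbRk rk1 rk2 s1 t1 s2 t2 d) := by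
    rintro (e | e)
    · simp only [dbTl, dbHd, Sum.elim_inl, rk_emb1 n1 hs1 ht1]; exact hrank1 e
    · simp only [dbTl, dbHd, Sum.elim_inr, rk_emb2 n2 hs2 ht2]; exact hrank2 e
  have hmin : ∀ x, (∀ e, dbTl tl1 tl2 s1 t1 s2 t2 e ≠ x) ↔ x = Sum.inr false := by
    intro x
    constructor
    · intro h
      have a1 : ∀ v, x = dbEmb1 s1 t1 s2 t2 v → v = s1 := by
        rintro v rfl
        refine (hmin1 v).1 fun e he => h (Sum.inl e) ?_
        simp [dbTl, he]
      have a2 : ∀ v, x = dbEmb2 s1 t1 s2 t2 v → v = s2 := by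
        rintro v rfl
        refine (hmin2 v).1 fun e he => h (Sum.inr e) ?_
        simp [dbTl, he]
      rcases x with (v | v) | (_ | _)
      · exact absurd (a1 v.1 (emb1_i v).symm) v.2.1
      · exact absurd (a2 v.1 (emb2_i v).symm) v.2.1
      · rfl
      · exact absurd (a1 t1 (emb1_t n1).symm) n1.symm
    · rintro rfl (e | e) he
      · simp only [dbTl, Sum.elim_inl] at he
        rw [← emb1_s (s1 := s1) (t1 := t1) (s2 := s2) (t2 := t2)] at he
        exact c1 e (emb1_inj n1 he)
      · simp only [dbTl, Sum.elim_inr] at he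
        rw [← emb2_s (s1 := s1) (t1 := t1) (s2 := s2) (t2 := t2)] at he
        exact c2 e (emb2_inj n2 he)
  obtain ⟨g1, hg1, hH1⟩ := key5 F hrank1 hmin1 hs1
  obtain ⟨g2, hg2, hH2⟩ := key5 F hrank2 hmin2 hs2
  obtain ⟨g, hg, hH⟩ := key5 F hR hmin (by simp [dbRk])
  have e1 : ∀ w, w ≠ s1 → g (dbEmb1 s1 t1 s2 t2 w) = g1 w := by
    refine g_emb hrank1 (emb1_inj n1) (rk_emb1 n1 hs1 ht1) ?_ ?_ c1 g1 g hg1 hg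
    · intro e; exact ⟨Sum.inl e, by simp [dbTl], by simp [dbHd]⟩
    · rintro (e | e) w hw h
      · simp only [dbHd, Sum.elim_inl] at h
        exact ⟨e, by simp [dbTl], emb1_inj n1 h⟩
      · simp only [dbHd, Sum.elim_inr] at h
        rcases emb_cross n1 n2 h.symm with h | h
        · exact absurd h.1 hw
        · exact absurd h.2 (m2 e)
  have e2 : ∀ w, w ≠ s2 → g (dbEmb2 s1 t1 s2 t2 w) = g2 w := by
    refine g_emb hrank2 (emb2_inj n2) (rk_emb2 n2 hs2 ht2) ?_ ?_ c2 g2 g hg2 hg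
    · intro e; exact ⟨Sum.inr e, by simp [dbTl], by simp [dbHd]⟩
    · rintro (e | e) w hw h
      · simp only [dbHd, Sum.elim_inl] at h
        rcases emb_cross n1 n2 h with h | h
        · exact absurd h.2 hw
        · exact absurd h.1 (m1 e)
      · simp only [dbHd, Sum.elim_inr] at h
        exact ⟨e, by simp [dbTl], emb2_inj n2 h⟩
  have f1 : g1 t1 = 1 := g_top m1 g1 hg1
  have f2 : g2 t2 = 1 := g_top m2 g2 hg2
  have f : g (Sum.inr true) = 1 := by
    rw [← emb1_t (s2 := s2) (t2 := t2) n1, e1 _ n1.symm, f1]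
  rw [hH, hH1, hH2, split_sum n1, split_sum n2, Fintype.sum_sum_type, Fintype.sum_sum_type,
    Fintype.sum_bool, f, f1, f2, hs1, hs2, ht1, ht2]
  have i1 : ∀ v : {v : V1 // v ≠ s1 ∧ v ≠ t1}, g (Sum.inl (Sum.inl v)) = g1 v.1 := fun v => by
    rw [← emb1_i v, e1 _ v.2.1]
  have i2 : ∀ v : {v : V2 // v ≠ s2 ∧ v ≠ t2}, g (Sum.inl (Sum.inr v)) = g2 v.1 := fun v => by
    rw [← emb2_i v, e2 _ v.2.1]
  simp only [i1, i2, dbRk]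
  simp
  ring

theorem delta (F : Type) [Field F] (d : ℕ) (hd : 1 ≤ d) :
    Ring.inverse (GLG.hilb F (fun _ : Unit => true) (fun _ : Unit => false)
          (fun b : Bool => if b then d else 0)) =
        1 - ∑ j ∈ Finset.Icc 1 d, (PowerSeries.X : PowerSeries ℤ) ^ j := by
  classical
  obtain ⟨g, hg, hH⟩ := key5 F (tl := fun _ : Unit => true) (hd := fun _ : Unit => false)
    (rk := fun b : Bool => if b then d else 0) (s := false)
    (fun e => by simp; omega) (fun v => by cases v <;> simp) (by simp)
  have h1 : g true = 1 := g_top (fun e => by simp) g hg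
  rw [hH, Fintype.sum_bool, h1]
  simp

end DB

/-- **Corollary 5.7.** Let `Γ₁`, `Γ₂` be finite generalized layered graphs,
each with a unique minimal vertex of rank `0` and a unique maximal vertex of rank `d ≥ 1`,
and let `Γ₁ ◊ Γ₂` be the double bouquet.  Then, in `ℤ[[z]]` (each Hilbert series has
constant term `1`, hence is invertible; `Ring.inverse` gives its inverse),
`H(A(Γ₁ ◊ Γ₂),z)⁻¹ = H(A(Γ₁),z)⁻¹ + H(A(Γ₂),z)⁻¹ - (1 - z - z² - ⋯ - z^d)`;
moreover `1 - z - ⋯ - z^d = H(A(Δ(d)),z)⁻¹` where `Δ(d)` is the generalized layered graph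
with two vertices of ranks `d` and `0` and a single edge between them. -/
theorem hilb_double_bouquet (F : Type) [Field F] {V1 E1 V2 E2 : Type}
    [Fintype V1] [Fintype E1] [Fintype V2] [Fintype E2]
    (tl1 hd1 : E1 → V1) (rk1 : V1 → ℕ) (hrank1 : GLG.IsRank tl1 hd1 rk1)
    (tl2 hd2 : E2 → V2) (rk2 : V2 → ℕ) (hrank2 : GLG.IsRank tl2 hd2 rk2)
    (d : ℕ) (hd1d : 1 ≤ d)
    (s1 : V1) (hs1 : rk1 s1 = 0) (hmin1 : ∀ v : V1, (∀ e : E1, tl1 e ≠ v) ↔ v = s1)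
    (s2 : V2) (hs2 : rk2 s2 = 0) (hmin2 : ∀ v : V2, (∀ e : E2, tl2 e ≠ v) ↔ v = s2)
    (t1 : V1) (ht1 : rk1 t1 = d) (hmax1 : ∀ v : V1, (∀ e : E1, hd1 e ≠ v) ↔ v = t1)
    (t2 : V2) (ht2 : rk2 t2 = d) (hmax2 : ∀ v : V2, (∀ e : E2, hd2 e ≠ v) ↔ v = t2) :
    Ring.inverse (GLG.hilb F (GLG.dbTl tl1 tl2 s1 t1 s2 t2) (GLG.dbHd hd1 hd2 s1 t1 s2 t2)
          (GLG.dbRk rk1 rk2 s1 t1 s2 t2 d)) =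
        Ring.inverse (GLG.hilb F tl1 hd1 rk1) + Ring.inverse (GLG.hilb F tl2 hd2 rk2) -
          (1 - ∑ j ∈ Finset.Icc 1 d, (PowerSeries.X : PowerSeries ℤ) ^ j) ∧
      Ring.inverse (GLG.hilb F (fun _ : Unit => true) (fun _ : Unit => false)
          (fun b : Bool => if b then d else 0)) =
        1 - ∑ j ∈ Finset.Icc 1 d, (PowerSeries.X : PowerSeries ℤ) ^ j := by
  exact ⟨DB.main F tl1 hd1 rk1 hrank1 tl2 hd2 rk2 hrank2 d hd1d s1 hs1 hmin1 s2 hs2 hmin2 t1 ht1 hmax1 t2 ht2 hmax2, DB.delta F d hd1d⟩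
end
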